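/- arXiv:2102.04547 — 2 statements merged into one kernel-verified Lean document; each statement's English description precedes it below -/
import Mathlib

section
/- Suppose γ < min{ (2/L)·1/(Ln²B + B + 1), 1/( L(B/2)(n+1) + L + (L/2)nB ) } (so that C₄ := γ − γ²L((B/2)(n+1) + 1) > 0). Then for all t ≥ 2B, with α(t) = f(x(t)) − f* and β(t) = γ² Σ_{τ=t−B}^{t−1} ‖s(τ)‖², one has α(t+B) ≤ (1 − C₁ − (C₂+C₃)/C₄) α(t) + ((C₂+C₃)/C₄)( α(t−B) + (L/2)nB β(t−B) ), where C₁ = −μ(γ⁴L²nB + γ²(LB + L) − 2γ), C₂ = (1/2)n²Bγ⁴L³ + (1/2)γ²L(L+1)n, and C₃ = (L/2)γ²nB. -/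
open scoped BigOperators
open Classical

/-- The descent lemma: a function with `L`-Lipschitz gradient lies below its quadratic model. -/
theorem le_quadratic_model_of_lipschitz_gradient {F : Type*} [NormedAddCommGroup F]
    [InnerProductSpace ℝ F] [CompleteSpace F] {f : F → ℝ} {L : ℝ} (hdiff : Differentiable ℝ f)
    (hLip : ∀ y z, ‖gradient f z - gradient f y‖ ≤ L * ‖z - y‖) (x h : F) :
    f (x + h) ≤ f x + inner ℝ (gradient f x) h + L / 2 * ‖h‖ ^ 2 := by
  set φ : ℝ → ℝ := fun r => f (x + r • h) - r * inner ℝ (gradient f x) h - L / 2 * r ^ 2 * ‖h‖ ^ 2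
  have hφ : ∀ r, HasDerivAt φ (inner ℝ (gradient f (x + r • h)) h - inner ℝ (gradient f x) h
      - L * r * ‖h‖ ^ 2) r := by
    intro r
    have h1 : HasDerivAt (fun r : ℝ => x + r • h) h r := by
      simpa using ((hasDerivAt_id r).smul_const h).const_add x
    have h2 : HasDerivAt (fun r : ℝ => f (x + r • h)) (inner ℝ (gradient f (x + r • h)) h) r := by
      have h3 := (hdiff (x + r • h)).hasGradientAt.hasFDerivAt.comp_hasDerivAt r h1
      simpa [Function.comp_def] using h3
    have h4 := (h2.sub ((hasDerivAt_id r).mul_const (inner ℝ (gradient f x) h))).sub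
      ((((hasDerivAt_id r).pow 2).const_mul (L / 2)).mul_const (‖h‖ ^ 2))
    refine h4.congr_deriv ?_
    simp only [id_eq]
    norm_num
    left
    ring
  have hanti : AntitoneOn φ (Set.Ici 0) := by
    refine antitoneOn_of_deriv_nonpos (convex_Ici 0)
      (fun r _ => (hφ r).continuousAt.continuousWithinAt)
      (fun r _ => (hφ r).differentiableAt.differentiableWithinAt) fun r hr => ?_
    rw [interior_Ici, Set.mem_Ioi] at hr
    rw [(hφ r).deriv, ← inner_sub_left]
    have h1 := real_inner_le_norm (gradient f (x + r • h) - gradient f x) h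
    have h2 := hLip x (x + r • h)
    rw [add_sub_cancel_left, norm_smul, Real.norm_of_nonneg hr.le] at h2
    nlinarith [norm_nonneg h]
  have := hanti (Set.mem_Ici.2 le_rfl) (Set.mem_Ici.2 zero_le_one) zero_le_one
  simp only [φ, one_smul, zero_smul, add_zero] at this
  linarith

theorem sq_sub_le_of_increments {y σ : ℕ → ℝ} {γ : ℝ} (hy : ∀ t, y (t + 1) = y t + γ * σ t)
    {a b : ℕ} (hab : a ≤ b) {J : Finset ℕ} (hJ : Finset.Ico a b ⊆ J) {k : ℝ}
    (hk : (b : ℝ) - a ≤ k) : (y b - y a) ^ 2 ≤ γ ^ 2 * (k * ∑ τ ∈ J, σ τ ^ 2) := by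
  have h1 : y b - y a = γ * ∑ τ ∈ Finset.Ico a b, σ τ := by
    induction b, hab using Nat.le_induction with
    | base => simp
    | succ b hb ih =>
      rw [Finset.sum_Ico_succ_top hb, hy, mul_add,
        ← ih ((Finset.Ico_subset_Ico_right (Nat.le_succ b)).trans hJ)
          (by push_cast at hk; linarith)]
      ring
  have h2 := sq_sum_le_card_mul_sum_sq (s := Finset.Ico a b) (f := σ)
  rw [Nat.card_Ico, Nat.cast_sub hab] at h2
  have h3 : ∑ τ ∈ Finset.Ico a b, σ τ ^ 2 ≤ ∑ τ ∈ J, σ τ ^ 2 :=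
    Finset.sum_le_sum_of_subset_of_nonneg hJ fun _ _ _ => sq_nonneg _
  have h4 : (0 : ℝ) ≤ b - a := by simpa using hab
  rw [h1, mul_pow]
  refine mul_le_mul_of_nonneg_left (h2.trans ?_) (sq_nonneg γ)
  exact mul_le_mul hk h3 (Finset.sum_nonneg fun _ _ => sq_nonneg _) (h4.trans hk)

theorem sum_range_cast (B : ℕ) : ∑ p ∈ Finset.range B, (p : ℝ) = B * (B - 1) / 2 := by
  induction B with
  | zero => simp
  | succ B ih => rw [Finset.sum_range_succ, ih]; push_cast; ring

/-- Selecting in every coordinate the entry of its own block costs at most a factor `n`. -/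
theorem sum_block_le {m n : ℕ} (blk : Fin m → Fin n) {F : Fin n → Fin m → ℝ}
    (hF : ∀ i c, 0 ≤ F i c) {K : ℝ} (hK : ∀ i, ∑ c, F i c ≤ K) :
    ∑ c, F (blk c) c ≤ n * K := by
  calc ∑ c, F (blk c) c ≤ ∑ c, ∑ i, F i c :=
        Finset.sum_le_sum fun c _ =>
          Finset.single_le_sum (f := fun i => F i c) (fun i _ => hF i c) (Finset.mem_univ _)
    _ = ∑ i, ∑ c, F i c := Finset.sum_comm
    _ ≤ ∑ _i : Fin n, K := Finset.sum_le_sum fun i _ => hK i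
    _ = n * K := by simp

/-- Progress made along one coordinate over a window. `b` is the partial derivative at the start of
the window, `U` the set of update times, `d` the error of the derivative that was used. -/
theorem coordinate_progress {U : Finset ℕ} {p : ℕ} (hp : p ∈ U) {B : ℕ} (hU : U.card ≤ B)
    {b g : ℝ} (hg : 0 < g) (hg2 : 2 * g ≤ 1) {s d : ℕ → ℝ} (hs : ∀ r ∈ U, s r = -(b + d r)) :
    b * (∑ r ∈ U, s r) + g / 2 * (∑ r ∈ U, s r) ^ 2 ≤
      -b ^ 2 + g / 2 * (B + 1) * b ^ 2 + (1 / (2 * g * B) + g / 2 + g * (B - 1)) * d p ^ 2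
        + 1 / 2 * (∑ r ∈ U, d r ^ 2)
        - 1 / 2 * (1 - g * B) * (∑ r ∈ U, s r ^ 2 - s p ^ 2) := by
  have hcard : ((U.erase p).card : ℝ) + 1 = U.card := by
    exact_mod_cast Finset.card_erase_add_one hp
  have hUB : (U.card : ℝ) ≤ B := by exact_mod_cast hU
  have hlin : b * ∑ r ∈ U.erase p, s r = -(1 / 2) * (U.erase p).card * b ^ 2
      - 1 / 2 * (∑ r ∈ U.erase p, s r ^ 2) + 1 / 2 * ∑ r ∈ U.erase p, d r ^ 2 := by
    rw [Finset.mul_sum, Finset.mul_sum, Finset.mul_sum,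
      show -(1 / 2) * ((U.erase p).card : ℝ) * b ^ 2 = ∑ _r ∈ U.erase p, -(1 / 2) * b ^ 2 by
        rw [Finset.sum_const, nsmul_eq_mul]; ring,
      ← Finset.sum_sub_distrib, ← Finset.sum_add_distrib]
    refine Finset.sum_congr rfl fun r hr => ?_
    rw [hs r (Finset.mem_of_mem_erase hr)]
    ring
  have hsq := sq_sum_le_card_mul_sum_sq (s := U) (f := s)
  have hsplit : ∑ r ∈ U, s r = s p + ∑ r ∈ U.erase p, s r := (Finset.add_sum_erase U s hp).symm
  have hsplit2 := Finset.add_sum_erase U (fun r => s r ^ 2) hp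
  have hsplit3 := Finset.add_sum_erase U (fun r => d r ^ 2) hp
  have hR : 0 ≤ ∑ r ∈ U.erase p, s r ^ 2 := Finset.sum_nonneg fun _ _ => sq_nonneg _
  have hsp := hs p hp
  set k : ℝ := ((U.erase p).card : ℝ)
  have hk0 : 0 ≤ k := Nat.cast_nonneg _
  set R := ∑ r ∈ U.erase p, s r ^ 2
  set D := ∑ r ∈ U.erase p, d r ^ 2
  rw [← hsplit2, ← hcard] at hsq
  rw [← hsplit2, ← hsplit3]
  have hB0 : (0 : ℝ) < B := by linarith
  have e1 : b * ∑ r ∈ U, s r = b * s p + (-(1 / 2) * k * b ^ 2 - 1 / 2 * R + 1 / 2 * D) := by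
    rw [hsplit, mul_add, hlin]
  have e2 : g / 2 * (∑ r ∈ U, s r) ^ 2 ≤ g / 2 * ((k + 1) * (s p ^ 2 + R)) :=
    mul_le_mul_of_nonneg_left hsq (by positivity)
  have e3 : g / 2 * (k * s p ^ 2) ≤ 1 / 2 * (k * b ^ 2) + g * (B - 1) * d p ^ 2 := by
    have t1 : s p ^ 2 ≤ 2 * b ^ 2 + 2 * d p ^ 2 := by
      rw [hsp]; nlinarith [sq_nonneg (b - d p)]
    have t2 : g / 2 * (k * s p ^ 2) ≤ g / 2 * (k * (2 * b ^ 2 + 2 * d p ^ 2)) := by gcongr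
    have t3 : g * k * b ^ 2 ≤ 1 / 2 * k * b ^ 2 := by gcongr; linarith
    have t4 : g * k * d p ^ 2 ≤ g * (B - 1) * d p ^ 2 := by gcongr; linarith
    linarith
  have e4 : g / 2 * ((k + 1) * R) ≤ g / 2 * (B * R) := by gcongr; linarith
  have e5 : -((1 - g) * (b * d p)) ≤ g / 2 * B * b ^ 2 + 1 / (2 * g * B) * d p ^ 2 := by
    have hgB : 0 < g * B := by positivity
    have t1 : g / 2 * B * b ^ 2 + 1 / (2 * g * B) * d p ^ 2 + (1 - g) * (b * d p) =
        ((g * B * b + (1 - g) * d p) ^ 2 + (1 - (1 - g) ^ 2) * d p ^ 2) / (2 * (g * B)) := by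
      field_simp
      ring
    have t2 : 0 ≤ 1 - (1 - g) ^ 2 := by nlinarith
    have : 0 ≤ ((g * B * b + (1 - g) * d p) ^ 2 + (1 - (1 - g) ^ 2) * d p ^ 2) / (2 * (g * B)) := by
      positivity
    linarith
  have e6 : 0 ≤ d p ^ 2 := sq_nonneg _
  have e7 : b * s p + g / 2 * s p ^ 2
      = -b ^ 2 + g / 2 * b ^ 2 + g / 2 * d p ^ 2 - (1 - g) * (b * d p) := by
    rw [hsp]; ring
  rw [e1]
  linarith

theorem sum_sq_eq_norm_sq {m : ℕ} (v : EuclideanSpace ℝ (Fin m)) : ∑ c, v c ^ 2 = ‖v‖ ^ 2 :=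
  (EuclideanSpace.real_norm_sq_eq v).symm

theorem inner_eq_sum_mul {m : ℕ} (v w : EuclideanSpace ℝ (Fin m)) :
    inner ℝ v w = ∑ c, v c * w c := by
  simp [PiLp.inner_apply, mul_comm]

theorem sum_window_sq {m : ℕ} (s : ℕ → EuclideanSpace ℝ (Fin m)) (γ k : ℝ) (J : Finset ℕ) :
    ∑ c, γ ^ 2 * (k * ∑ τ ∈ J, s τ c ^ 2) = γ ^ 2 * (k * ∑ τ ∈ J, ‖s τ‖ ^ 2) := by
  simp_rw [← Finset.mul_sum, ← sum_sq_eq_norm_sq]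
  rw [Finset.sum_comm]

theorem window_ratio_le {n B z : ℝ} (hn : 2 ≤ n) (hB : B = 1 ∨ 2 ≤ B)
    (hz : n * B + B / 2 + 1 ≤ z) : 16 * (n * (B - 1)) ≤ z ^ 2 := by
  obtain ⟨u, hu, rfl⟩ : ∃ u, 0 ≤ u ∧ n = 2 + u := ⟨n - 2, by linarith, by ring⟩
  obtain ⟨w, hw, rfl⟩ : ∃ w, 0 ≤ w ∧ z = (2 + u) * B + B / 2 + 1 + w :=
    ⟨z - ((2 + u) * B + B / 2 + 1), by linarith, by ring⟩
  rcases hB with rfl | hB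
  · nlinarith [sq_nonneg ((2 + u) * 1 + 1 / 2 + 1 + w)]
  obtain ⟨v, hv, rfl⟩ : ∃ v, 0 ≤ v ∧ B = 2 + v := ⟨B - 2, by linarith, by ring⟩
  rw [← sub_nonneg]
  have : ((2 + u) * (2 + v) + (2 + v) / 2 + 1 + w) ^ 2 - 16 * ((2 + u) * (2 + v - 1)) =
      (6 * (v - 1 / 6) ^ 2 + 4 - 1 / 6) + (v ^ 2 / 4 + 8 * u + 6 * u * v + 12 * w + 4 * u ^ 2
        + 5 * u * v ^ 2 + 4 * u ^ 2 * v + u ^ 2 * v ^ 2 + 4 * u * w + 5 * v * w + 2 * u * v * w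
        + w ^ 2) := by
    ring
  rw [this]
  refine add_nonneg ?_ (by positivity)
  linarith [sq_nonneg (v - 1 / 6)]

/-- Coefficient comparison for the energy of the window preceding the current time. The variable
`z` stands for `1 / (L * γ)` here and in the next two lemmas. -/
theorem current_window_coeff_nonneg {n B z : ℝ} (hn : 2 ≤ n) (hB : B = 1 ∨ 2 ≤ B)
    (hz : n * B + B / 2 + 1 ≤ z) :
    0 ≤ 54 * B * (B + 1) * z ^ 4 * (2 * (z - (B * (n + 1) / 2 + 1)) + (n + 2)) -
      2 * (z - (B * (n + 1) / 2 + 1)) *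
        (2 * (B - 1) * z ^ 2 + 2 * B * (B - 1) * (2 * B - 1) + (B - 1) * B ^ 2 * z) *
        (91 * z ^ 2 + 3 * n * (176 * B - 112)) := by
  obtain ⟨u, hu, rfl⟩ : ∃ u, 0 ≤ u ∧ n = 2 + u := ⟨n - 2, by linarith, by ring⟩
  obtain ⟨w, hw, rfl⟩ : ∃ w, 0 ≤ w ∧ z = (2 + u) * B + B / 2 + 1 + w :=
    ⟨z - ((2 + u) * B + B / 2 + 1), by linarith, by ring⟩
  rcases hB with rfl | hB
  · ring_nf
    positivity
  obtain ⟨v, hv, rfl⟩ : ∃ v, 0 ≤ v ∧ B = 2 + v := ⟨B - 2, by linarith, by ring⟩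
  ring_nf
  positivity

/-- Coefficient comparison for the energy of the window before that one. -/
theorem previous_window_coeff_nonneg {n B z : ℝ} (hn : 2 ≤ n) (hB : B = 1 ∨ 2 ≤ B)
    (hz : n * B + B / 2 + 1 ≤ z) :
    0 ≤ 9 * B * z ^ 4 * (B + 1) * (n * B - (B - 1)) -
      (2 * (B - 1) * z ^ 2 + 2 * B * (B - 1) * (2 * B - 1) + (B - 1) * B ^ 2 * z) *
        (64 * n * (2 * B - 1)) * (z - (B * (n + 1) / 2 + 1)) := by
  obtain ⟨u, hu, rfl⟩ : ∃ u, 0 ≤ u ∧ n = 2 + u := ⟨n - 2, by linarith, by ring⟩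
  obtain ⟨w, hw, rfl⟩ : ∃ w, 0 ≤ w ∧ z = (2 + u) * B + B / 2 + 1 + w :=
    ⟨z - ((2 + u) * B + B / 2 + 1), by linarith, by ring⟩
  rcases hB with rfl | hB
  · ring_nf
    positivity
  obtain ⟨v, hv, rfl⟩ : ∃ v, 0 ≤ v ∧ B = 2 + v := ⟨B - 2, by linarith, by ring⟩
  ring_nf
  positivity

/-- Coefficient comparison for the energy of repeated updates in the coming window. -/
theorem repeated_update_coeff_nonneg {n B z : ℝ} (hn : 2 ≤ n) (hB : B = 1 ∨ 2 ≤ B)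
    (hz : n * B + B / 2 + 1 ≤ z) :
    0 ≤ 6 * B * z ^ 2 * (z - B) -
      4 * n * (2 * (B - 1) * z ^ 2 + 2 * B * (B - 1) * (2 * B - 1) + (B - 1) * B ^ 2 * z) := by
  obtain ⟨u, hu, rfl⟩ : ∃ u, 0 ≤ u ∧ n = 2 + u := ⟨n - 2, by linarith, by ring⟩
  obtain ⟨w, hw, rfl⟩ : ∃ w, 0 ≤ w ∧ z = (2 + u) * B + B / 2 + 1 + w :=
    ⟨z - ((2 + u) * B + B / 2 + 1), by linarith, by ring⟩
  rcases hB with rfl | hB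
  · ring_nf
    positivity
  obtain ⟨v, hv, rfl⟩ : ∃ v, 0 ≤ v ∧ B = 2 + v := ⟨B - 2, by linarith, by ring⟩
  ring_nf
  positivity

/-- The error terms of a window, with energy `S`, are bounded by the energies `P1` and `P2` of the
two preceding windows. -/
theorem window_error_le {n B g b2 P1 P2 S R D : ℝ} (hn : 2 ≤ n) (hB : B = 1 ∨ 2 ≤ B)
    (hg : 0 < g) (hgz : g * (n * B + B / 2 + 1) ≤ 1) (hP1 : 0 ≤ P1) (hP2 : 0 ≤ P2) (hS0 : 0 ≤ S)
    (hR : 0 ≤ R) (hD : D ≤ n * (g ^ 2 * ((B - 1) * (S + P1))))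
    (hS : S ≤ 4 / 3 * b2 + 4 * D + R)
    (hb2 : b2 ≤ 4 / 3 * P1 + 4 * (n * (g ^ 2 * ((2 * B - 1) * (P2 + P1))))) :
    (1 / (2 * g * B) + g / 2 + g * (B - 1)) * D
        + 1 / 2 * (n * (g ^ 2 * (B * (B - 1) / 2 * (S + P1)))) - 1 / 2 * (1 - g * B) * R ≤
      g / 2 * n * (B + 1) * (P1 + ((n + 2) * P1 + (n * B - (B - 1)) * P2) /
        (2 * (1 / g - (B * (n + 1) / 2 + 1)))) := by
  have hB1 : 1 ≤ B := by rcases hB with h | h <;> linarith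
  obtain ⟨z, hz0, rfl⟩ : ∃ z, 0 < z ∧ g = 1 / z := ⟨1 / g, by positivity, by simp⟩
  have hz : n * B + B / 2 + 1 ≤ z := by
    rwa [div_mul_eq_mul_div, one_mul, div_le_one hz0] at hgz
  have hh : 0 < z - (B * (n + 1) / 2 + 1) := by nlinarith
  have h1 := current_window_coeff_nonneg hn hB hz
  have h2 := previous_window_coeff_nonneg hn hB hz
  have h3 := repeated_update_coeff_nonneg hn hB hz
  have h0 := window_ratio_le hn hB hz
  rw [one_div_one_div]
  set h := z - (B * (n + 1) / 2 + 1) with hhdef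
  set κ := n * (2 * (B - 1) * z ^ 2 + 2 * B * (B - 1) * (2 * B - 1) + (B - 1) * B ^ 2 * z) /
    (2 * B * z ^ 2) with hκ
  have hq : 0 ≤ B - 1 := by linarith
  have hκ0 : 0 ≤ κ := by
    have : 0 ≤ 2 * B - 1 := by linarith
    positivity
  have k1 : κ * (91 / 27 + n * (176 * B - 112) / (9 * z ^ 2)) ≤
      n * (B + 1) * (1 + (n + 2) / (2 * h)) := by
    rw [← sub_nonneg, hκ]
    refine le_of_le_of_eq (div_nonneg (mul_nonneg (by linarith : 0 ≤ n) h1)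
      (by positivity : 0 ≤ 108 * B * z ^ 4 * h)) ?_
    field_simp
    ring
  have k2 : κ * (64 * n * (2 * B - 1) / (9 * z ^ 2)) ≤
      n * (B + 1) * ((n * B - (B - 1)) / (2 * h)) := by
    rw [← sub_nonneg, hκ]
    refine le_of_le_of_eq (div_nonneg (mul_nonneg (by linarith : 0 ≤ n) h2)
      (by positivity : 0 ≤ 18 * B * z ^ 4 * h)) ?_
    field_simp
    ring
  have k3 : κ * (4 / 3) ≤ z - B := by
    rw [← sub_nonneg, hκ]
    refine le_of_le_of_eq (div_nonneg h3 (by positivity : 0 ≤ 6 * B * z ^ 2)) ?_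
    field_simp
    ring
  have hρ : n * ((1 / z) ^ 2 * (B - 1)) ≤ 1 / 16 := by
    rw [div_pow, one_pow, ← sub_nonneg]
    refine le_of_le_of_eq (div_nonneg (sub_nonneg.2 h0) (by positivity : 0 ≤ 16 * z ^ 2)) ?_
    field_simp
  have hSP : S + P1 ≤ (91 / 27 + n * (176 * B - 112) / (9 * z ^ 2)) * P1
      + 64 * n * (2 * B - 1) / (9 * z ^ 2) * P2 + 4 / 3 * R := by
    have e1 : S ≤ 4 / 3 * (4 / 3 * b2 + 4 * (n * ((1 / z) ^ 2 * (B - 1))) * P1 + R) := by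
      have := mul_le_mul_of_nonneg_right hρ hS0
      linarith
    refine le_of_le_of_eq (?_ : S + P1 ≤ 4 / 3 * (4 / 3 * (4 / 3 * P1
      + 4 * (n * ((1 / z) ^ 2 * ((2 * B - 1) * (P2 + P1)))))
      + 4 * (n * ((1 / z) ^ 2 * (B - 1))) * P1 + R) + P1) ?_
    · linarith
    · field_simp
      ring
  have hE : (1 / (2 * (1 / z) * B) + 1 / z / 2 + 1 / z * (B - 1)) * D
      + 1 / 2 * (n * ((1 / z) ^ 2 * (B * (B - 1) / 2 * (S + P1))))
      - 1 / 2 * (1 - 1 / z * B) * R ≤ 1 / (2 * z) * (κ * (S + P1) - (z - B) * R) := by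
    have e1 := mul_le_mul_of_nonneg_left hD
      (by positivity : 0 ≤ 1 / (2 * (1 / z) * B) + 1 / z / 2 + 1 / z * (B - 1))
    have e2 : 1 / (2 * z) * (κ * (S + P1) - (z - B) * R) =
      (1 / (2 * (1 / z) * B) + 1 / z / 2 + 1 / z * (B - 1)) *
        (n * ((1 / z) ^ 2 * ((B - 1) * (S + P1))))
      + 1 / 2 * (n * ((1 / z) ^ 2 * (B * (B - 1) / 2 * (S + P1))))
      - 1 / 2 * (1 - 1 / z * B) * R := by
      rw [hκ]
      field_simp
      ring
    linarith
  refine hE.trans ?_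
  rw [show 1 / z / 2 * n * (B + 1) * (P1 + ((n + 2) * P1 + (n * B - (B - 1)) * P2) / (2 * h)) =
    1 / (2 * z) * (n * (B + 1) * (1 + (n + 2) / (2 * h)) * P1
      + n * (B + 1) * ((n * B - (B - 1)) / (2 * h)) * P2) by
    field_simp
    ring]
  refine mul_le_mul_of_nonneg_left ?_ (by positivity)
  have f1 := mul_le_mul_of_nonneg_left hSP hκ0
  have f2 := mul_le_mul_of_nonneg_right k1 hP1
  have f3 := mul_le_mul_of_nonneg_right k2 hP2
  have f4 := mul_le_mul_of_nonneg_right k3 hR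
  linarith

section Async

variable {m n B : ℕ} {f : EuclideanSpace ℝ (Fin m) → ℝ} {L γ : ℝ}
  {blk : Fin m → Fin n} {T : Fin n → Set ℕ}
  {X : Fin n → ℕ → EuclideanSpace ℝ (Fin m)} {x s : ℕ → EuclideanSpace ℝ (Fin m)}

theorem sq_norm_view_sub_le {i : Fin n} {t t' : ℕ} {Q : Fin m → ℝ}
    (hview : ∀ c, ∃ σ, σ ≤ t' ∧ t' < σ + B ∧ X i t' c = x σ c)
    (hQ : ∀ c σ, σ ≤ t' → t' < σ + B → (x σ c - x t c) ^ 2 ≤ Q c) :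
    ‖X i t' - x t‖ ^ 2 ≤ ∑ c, Q c := by
  rw [← sum_sq_eq_norm_sq]
  refine Finset.sum_le_sum fun c _ => ?_
  obtain ⟨σ, h1, h2, h3⟩ := hview c
  rw [PiLp.sub_apply, h3]
  exact hQ c σ h1 h2

theorem sq_norm_view_sub_le_forward (hstep : ∀ t c, x (t + 1) c = x t c + γ * s t c)
    (hview : ∀ i, ∀ t ∈ T i, ∀ c, ∃ σ, σ ≤ t ∧ t < σ + B ∧ X i t c = x σ c)
    {i : Fin n} {t t' : ℕ} (hi : t' ∈ T i) (hB : B ≤ t) (h1 : t ≤ t') (h2 : t' < t + B) :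
    ‖X i t' - x t‖ ^ 2 ≤ γ ^ 2 * (((t' : ℝ) - t) * ∑ τ ∈ Finset.Ico t (t + B), ‖s τ‖ ^ 2)
      + γ ^ 2 * (((t : ℝ) + B - 1 - t') * ∑ τ ∈ Finset.Ico (t - B) t, ‖s τ‖ ^ 2) := by
  rw [← sum_window_sq, ← sum_window_sq, ← Finset.sum_add_distrib]
  have k1 : (t : ℝ) ≤ t' := by exact_mod_cast h1
  have k2 : (t' : ℝ) + 1 ≤ t + B := by exact_mod_cast h2
  refine sq_norm_view_sub_le (hview i t' hi) fun c σ h3 h4 => ?_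
  have p1 : 0 ≤ γ ^ 2 * (((t' : ℝ) - t) * ∑ τ ∈ Finset.Ico t (t + B), s τ c ^ 2) :=
    mul_nonneg (sq_nonneg γ)
      (mul_nonneg (by linarith) (Finset.sum_nonneg fun _ _ => sq_nonneg _))
  have p2 : 0 ≤ γ ^ 2 * (((t : ℝ) + B - 1 - t') * ∑ τ ∈ Finset.Ico (t - B) t, s τ c ^ 2) :=
    mul_nonneg (sq_nonneg γ)
      (mul_nonneg (by linarith) (Finset.sum_nonneg fun _ _ => sq_nonneg _))
  rcases le_total t σ with h5 | h5
  · have k3 : (σ : ℝ) ≤ t' := by exact_mod_cast h3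
    have := sq_sub_le_of_increments (y := fun t => x t c) (σ := fun t => s t c)
      (fun t => hstep t c) h5 (J := Finset.Ico t (t + B))
      (Finset.Ico_subset_Ico_right (by omega)) (k := (t' : ℝ) - t) (by linarith)
    linarith
  · have k3 : (t' : ℝ) + 1 ≤ σ + B := by exact_mod_cast h4
    have := sq_sub_le_of_increments (y := fun t => x t c) (σ := fun t => s t c)
      (fun t => hstep t c) h5 (J := Finset.Ico (t - B) t)
      (Finset.Ico_subset_Ico_left (by omega)) (k := (t : ℝ) + B - 1 - t') (by linarith)
    rw [← neg_sub, neg_sq] at this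
    linarith

/-- A view at time `t'` compared with a later true state `x t`. -/
theorem sq_norm_view_sub_le_backward (hstep : ∀ t c, x (t + 1) c = x t c + γ * s t c)
    (hview : ∀ i, ∀ t ∈ T i, ∀ c, ∃ σ, σ ≤ t ∧ t < σ + B ∧ X i t c = x σ c)
    {i : Fin n} {r t t' : ℕ} (hi : t' ∈ T i) (h1 : t' ≤ t) (h2 : r + B ≤ t' + 1) :
    ‖X i t' - x t‖ ^ 2 ≤ γ ^ 2 * (((t : ℝ) - r) * ∑ τ ∈ Finset.Ico r t, ‖s τ‖ ^ 2) := by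
  rw [← sum_window_sq]
  refine sq_norm_view_sub_le (hview i t' hi) fun c σ h3 h4 => ?_
  have k1 : (r : ℝ) ≤ σ := by
    have : r ≤ σ := by omega
    exact_mod_cast this
  have := sq_sub_le_of_increments (y := fun t => x t c) (σ := fun t => s t c)
    (fun t => hstep t c) (h3.trans h1) (J := Finset.Ico r t)
    (Finset.Ico_subset_Ico_left (by omega)) (k := (t : ℝ) - r) (by linarith)
  rwa [← neg_sub, neg_sq] at this

theorem sum_sq_gradient_sub_le
    (hLip : ∀ y z, ‖gradient f z - gradient f y‖ ≤ L * ‖z - y‖)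
    (y z : EuclideanSpace ℝ (Fin m)) :
    ∑ c, (gradient f z c - gradient f y c) ^ 2 ≤ L ^ 2 * ‖z - y‖ ^ 2 := by
  have h := sum_sq_eq_norm_sq (gradient f z - gradient f y)
  simp only [PiLp.sub_apply] at h
  rw [h, ← mul_pow]
  exact pow_le_pow_left₀ (norm_nonneg _) (hLip y z) 2

/-- One step of the iteration, with the error of the views charged to the recent steps. -/
theorem step_descent (hL : 0 < L) (hγ : 0 < γ) (hdiff : Differentiable ℝ f)
    (hLip : ∀ y z, ‖gradient f z - gradient f y‖ ≤ L * ‖z - y‖)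
    (hstep : ∀ t c, x (t + 1) c = x t c + γ * s t c)
    (hs : ∀ t c, s t c = if t ∈ T (blk c) then -(gradient f (X (blk c) t) c) else 0)
    {t : ℕ} {V : ℝ} (hV0 : 0 ≤ V)
    (hV : ∀ i, t ∈ T i → ‖X i t - x t‖ ^ 2 ≤ γ ^ 2 * V) {q : ℝ} (hq : 0 ≤ q) {W : ℝ}
    (hW : 0 ≤ W) (hVW : V = q * W) :
    f (x (t + 1)) ≤ f (x t) - γ * (1 - 1 / 2 * (L * γ) - 1 / 2 * (L * γ) * n * q) * ‖s t‖ ^ 2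
      + 1 / 2 * γ * (L * γ) * W := by
  have hxs : x (t + 1) = x t + γ • s t := by
    ext c
    simp [hstep]
  have h1 := le_quadratic_model_of_lipschitz_gradient hdiff hLip (x t) (γ • s t)
  rw [← hxs, norm_smul, Real.norm_of_nonneg hγ.le, inner_smul_right] at h1
  set e : Fin n → Fin m → ℝ := fun i c =>
    if t ∈ T i then gradient f (X i t) c - gradient f (x t) c else 0 with he
  have h2 : inner ℝ (gradient f (x t)) (s t) = -‖s t‖ ^ 2 - ∑ c, s t c * e (blk c) c := by
    rw [inner_eq_sum_mul, ← sum_sq_eq_norm_sq, ← Finset.sum_neg_distrib,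
      ← Finset.sum_sub_distrib]
    refine Finset.sum_congr rfl fun c _ => ?_
    rw [hs, he]
    by_cases h : t ∈ T (blk c)
    · simp only [h, if_true]; ring
    · simp [h]
  have h3 : ∑ c, e (blk c) c ^ 2 ≤ n * (L ^ 2 * (γ ^ 2 * V)) := by
    refine sum_block_le blk (F := fun i c => e i c ^ 2) (fun _ _ => sq_nonneg _) fun i => ?_
    by_cases h : t ∈ T i
    · simp only [he, h, if_true]
      exact (sum_sq_gradient_sub_le hLip _ _).trans
        (mul_le_mul_of_nonneg_left (hV i h) (sq_nonneg L))
    · simp only [he, h, if_false]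
      simp
      positivity
  have h4 := Finset.sum_mul_sq_le_sq_mul_sq Finset.univ (fun c => s t c) (fun c => e (blk c) c)
  rw [sum_sq_eq_norm_sq] at h4
  set N := ‖s t‖ ^ 2 with hN
  have hN0 : 0 ≤ N := sq_nonneg _
  have hn0 : (0 : ℝ) ≤ n := Nat.cast_nonneg _
  have h5 : |∑ c, s t c * e (blk c) c| ≤ 1 / 2 * (L * γ) * (n * q * N + W) := by
    refine abs_le_of_sq_le_sq ?_ (by positivity)
    refine h4.trans ((mul_le_mul_of_nonneg_left h3 hN0).trans ?_)
    have : 1 / 4 * (L * γ) ^ 2 * (4 * (n * q * N) * W) ≤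
        1 / 4 * (L * γ) ^ 2 * (n * q * N + W) ^ 2 := by
      refine mul_le_mul_of_nonneg_left ?_ (by positivity)
      nlinarith [sq_nonneg (n * q * N - W)]
    rw [hVW]
    linarith
  have h6 : γ * -(∑ c, s t c * e (blk c) c) ≤ γ * (1 / 2 * (L * γ) * (n * q * N + W)) :=
    mul_le_mul_of_nonneg_left ((neg_le_abs _).trans h5) hγ.le
  rw [h2, mul_pow, ← hN] at h1
  linarith

theorem sum_sum_Ico_le {N : ℕ → ℝ} (hN : ∀ t, 0 ≤ N t) (r : ℕ) (hB : 1 ≤ B) :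
    ∑ t ∈ Finset.Ico (r + B) (r + B + B), ∑ τ ∈ Finset.Ico (t + 1 - B) t, N τ ≤
      ((B : ℝ) - 1) * ∑ τ ∈ Finset.Ico r (r + B + B), N τ := by
  have h1 : ∀ t ∈ Finset.Ico (r + B) (r + B + B), ∑ τ ∈ Finset.Ico (t + 1 - B) t, N τ =
      ∑ d ∈ Finset.range (B - 1), N (t + 1 - B + d) := by
    intro t ht
    rw [Finset.mem_Ico] at ht
    rw [Finset.sum_Ico_eq_sum_range]
    congr 2
    omega
  rw [Finset.sum_congr rfl h1, Finset.sum_comm]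
  have h2 : ∀ d ∈ Finset.range (B - 1), ∑ t ∈ Finset.Ico (r + B) (r + B + B), N (t + 1 - B + d) ≤
      ∑ τ ∈ Finset.Ico r (r + B + B), N τ := by
    intro d hd
    rw [Finset.mem_range] at hd
    have hinj : Set.InjOn (fun t => t + 1 - B + d) (Finset.Ico (r + B) (r + B + B)) := by
      intro a ha b hb hab
      simp only [Finset.coe_Ico, Set.mem_Ico] at ha hb hab
      omega
    rw [← Finset.sum_image (f := N) hinj]
    refine Finset.sum_le_sum_of_subset_of_nonneg ?_ fun _ _ _ => hN _
    intro a ha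
    simp only [Finset.mem_image, Finset.mem_Ico] at ha ⊢
    omega
  refine (Finset.sum_le_sum h2).trans ?_
  rw [Finset.sum_const, Finset.card_range, nsmul_eq_mul, Nat.cast_sub hB, Nat.cast_one]

/-- Descent over the window `[r + B, r + 2 * B)`. -/
theorem window_descent (hB : 1 ≤ B) (hL : 0 < L) (hγ : 0 < γ) (hdiff : Differentiable ℝ f)
    (hLip : ∀ y z, ‖gradient f z - gradient f y‖ ≤ L * ‖z - y‖)
    (hstep : ∀ t c, x (t + 1) c = x t c + γ * s t c)
    (hview : ∀ i, ∀ t ∈ T i, ∀ c, ∃ σ, σ ≤ t ∧ t < σ + B ∧ X i t c = x σ c)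
    (hs : ∀ t c, s t c = if t ∈ T (blk c) then -(gradient f (X (blk c) t) c) else 0) (r : ℕ) :
    f (x (r + B + B)) ≤ f (x (r + B))
      - γ * (1 - 1 / 2 * (L * γ) - 1 / 2 * (L * γ) * n * (B - 1) - 1 / 2 * (L * γ) * (B - 1)) *
        ∑ τ ∈ Finset.Ico (r + B) (r + B + B), ‖s τ‖ ^ 2
      + 1 / 2 * γ * (L * γ) * (B - 1) * ∑ τ ∈ Finset.Ico r (r + B), ‖s τ‖ ^ 2 := by
  have hq : (0 : ℝ) ≤ B - 1 := by
    have : (1 : ℝ) ≤ B := by exact_mod_cast hB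
    linarith
  have h1 : ∀ t ∈ Finset.Ico (r + B) (r + B + B), f (x (t + 1)) - f (x t) ≤
      -(γ * (1 - 1 / 2 * (L * γ) - 1 / 2 * (L * γ) * n * (B - 1))) * ‖s t‖ ^ 2
      + 1 / 2 * γ * (L * γ) * ∑ τ ∈ Finset.Ico (t + 1 - B) t, ‖s τ‖ ^ 2 := by
    intro t ht
    rw [Finset.mem_Ico] at ht
    have hW : 0 ≤ ∑ τ ∈ Finset.Ico (t + 1 - B) t, ‖s τ‖ ^ 2 :=
      Finset.sum_nonneg fun _ _ => sq_nonneg _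
    have := step_descent hL hγ hdiff hLip hstep hs (t := t) (mul_nonneg hq hW) (fun i hi => by
      have h := sq_norm_view_sub_le_backward hstep hview hi le_rfl (r := t + 1 - B) (by omega)
      rw [Nat.cast_sub (by omega)] at h
      push_cast at h
      rwa [show (t : ℝ) - (t + 1 - B) = B - 1 by ring] at h) hq hW rfl
    linarith
  have h2 := Finset.sum_le_sum h1
  rw [Finset.sum_Ico_sub (fun t => f (x t)) (by omega), Finset.sum_add_distrib, ← Finset.mul_sum,
    ← Finset.mul_sum] at h2
  have h3 := sum_sum_Ico_le (N := fun τ => ‖s τ‖ ^ 2) (fun _ => sq_nonneg _) r hB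
  rw [← Finset.sum_Ico_consecutive _ (Nat.le_add_right r B) (Nat.le_add_right (r + B) B)] at h3
  have h4 := mul_le_mul_of_nonneg_left h3 (show 0 ≤ 1 / 2 * γ * (L * γ) by positivity)
  linarith

/-- The gradient after a window is controlled by the updates of the last two windows. -/
theorem gradient_sq_le
    (hLip : ∀ y z, ‖gradient f z - gradient f y‖ ≤ L * ‖z - y‖)
    (hstep : ∀ t c, x (t + 1) c = x t c + γ * s t c)
    (hview : ∀ i, ∀ t ∈ T i, ∀ c, ∃ σ, σ ≤ t ∧ t < σ + B ∧ X i t c = x σ c)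
    (hs : ∀ t c, s t c = if t ∈ T (blk c) then -(gradient f (X (blk c) t) c) else 0)
    (hasync1 : ∀ i t, ∃ t' ∈ Finset.Ico t (t + B), t' ∈ T i) (r : ℕ) :
    ‖gradient f (x (r + B + B))‖ ^ 2 ≤ 4 / 3 * ∑ τ ∈ Finset.Ico (r + B) (r + B + B), ‖s τ‖ ^ 2
      + 4 * (n * ((L * γ) ^ 2 * ((2 * B - 1) * (∑ τ ∈ Finset.Ico r (r + B), ‖s τ‖ ^ 2
        + ∑ τ ∈ Finset.Ico (r + B) (r + B + B), ‖s τ‖ ^ 2)))) := by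
  choose p hp hpT using fun i => hasync1 i (r + B)
  have h1 : ∑ c, (gradient f (X (blk c) (p (blk c))) c - gradient f (x (r + B + B)) c) ^ 2 ≤
      n * ((L * γ) ^ 2 * ((2 * B - 1) * (∑ τ ∈ Finset.Ico r (r + B), ‖s τ‖ ^ 2
        + ∑ τ ∈ Finset.Ico (r + B) (r + B + B), ‖s τ‖ ^ 2))) := by
    refine sum_block_le blk
      (F := fun i c => (gradient f (X i (p i)) c - gradient f (x (r + B + B)) c) ^ 2)
      (fun _ _ => sq_nonneg _) fun i => ?_
    refine (sum_sq_gradient_sub_le hLip _ _).trans ?_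
    have hpi := Finset.mem_Ico.1 (hp i)
    have h2 := sq_norm_view_sub_le_backward hstep hview (hpT i) hpi.2.le (r := r + 1) (by omega)
    have h3 : ∑ τ ∈ Finset.Ico (r + 1) (r + B + B), ‖s τ‖ ^ 2 ≤
        ∑ τ ∈ Finset.Ico r (r + B + B), ‖s τ‖ ^ 2 :=
      Finset.sum_le_sum_of_subset_of_nonneg (Finset.Ico_subset_Ico_left (Nat.le_succ r))
        fun _ _ _ => sq_nonneg _
    rw [Finset.sum_Ico_consecutive _ (Nat.le_add_right r B) (Nat.le_add_right (r + B) B), mul_pow,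
      mul_assoc]
    refine mul_le_mul_of_nonneg_left (h2.trans ?_) (sq_nonneg L)
    refine mul_le_mul_of_nonneg_left ?_ (sq_nonneg γ)
    push_cast
    rw [show (r : ℝ) + B + B - (r + 1) = 2 * B - 1 by ring]
    have hB : (1 : ℝ) ≤ B := by
      have : 1 ≤ B := by omega
      exact_mod_cast this
    exact mul_le_mul_of_nonneg_left h3 (by linarith)
  have h2 : ∑ c, s (p (blk c)) c ^ 2 ≤ ∑ τ ∈ Finset.Ico (r + B) (r + B + B), ‖s τ‖ ^ 2 := by
    simp_rw [← sum_sq_eq_norm_sq]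
    rw [Finset.sum_comm]
    exact Finset.sum_le_sum fun c _ => Finset.single_le_sum (f := fun τ => s τ c ^ 2)
      (fun _ _ => sq_nonneg _) (hp (blk c))
  have h3 : ‖gradient f (x (r + B + B))‖ ^ 2 ≤ 4 / 3 * ∑ c, s (p (blk c)) c ^ 2 + 4 *
      ∑ c, (gradient f (X (blk c) (p (blk c))) c - gradient f (x (r + B + B)) c) ^ 2 := by
    rw [← sum_sq_eq_norm_sq, Finset.mul_sum, Finset.mul_sum, ← Finset.sum_add_distrib]
    refine Finset.sum_le_sum fun c _ => ?_
    rw [hs, if_pos (hpT (blk c))]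
    nlinarith [sq_nonneg (gradient f (X (blk c) (p (blk c))) c
      + 3 * (gradient f (X (blk c) (p (blk c))) c - gradient f (x (r + B + B)) c))]
  linarith

theorem add_window (hstep : ∀ t c, x (t + 1) c = x t c + γ * s t c) (t k : ℕ) :
    x (t + k) = x t + γ • ∑ τ ∈ Finset.Ico t (t + k), s τ := by
  induction k with
  | zero => simp
  | succ k ih =>
    rw [← add_assoc, Finset.sum_Ico_succ_top (Nat.le_add_right t k), smul_add, ← add_assoc, ← ih]
    ext c
    simp [hstep]

/-- Progress over the window `[t, t + B)` relative to the gradient at its start. `R` collects the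
repeated updates and `D` the error of one selected update in every block. -/
theorem window_progress (hL : 0 < L) (hγ : 0 < γ) (hg : 2 * (L * γ) ≤ 1)
    (hdiff : Differentiable ℝ f)
    (hLip : ∀ y z, ‖gradient f z - gradient f y‖ ≤ L * ‖z - y‖)
    (hstep : ∀ t c, x (t + 1) c = x t c + γ * s t c)
    (hview : ∀ i, ∀ t ∈ T i, ∀ c, ∃ σ, σ ≤ t ∧ t < σ + B ∧ X i t c = x σ c)
    (hs : ∀ t c, s t c = if t ∈ T (blk c) then -(gradient f (X (blk c) t) c) else 0)
    (hasync1 : ∀ i t, ∃ t' ∈ Finset.Ico t (t + B), t' ∈ T i) {t : ℕ} (htB : B ≤ t) {P : ℝ}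
    (hP : P = ∑ τ ∈ Finset.Ico t (t + B), ‖s τ‖ ^ 2 + ∑ τ ∈ Finset.Ico (t - B) t, ‖s τ‖ ^ 2) :
    ∃ R D : ℝ, 0 ≤ R ∧ 0 ≤ D ∧ D ≤ n * ((L * γ) ^ 2 * ((B - 1) * P)) ∧
      ∑ τ ∈ Finset.Ico t (t + B), ‖s τ‖ ^ 2 ≤ 4 / 3 * ‖gradient f (x t)‖ ^ 2 + 4 * D + R ∧
      f (x (t + B)) ≤ f (x t) + γ * (-‖gradient f (x t)‖ ^ 2
        + L * γ / 2 * (B + 1) * ‖gradient f (x t)‖ ^ 2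
        + (1 / (2 * (L * γ) * B) + L * γ / 2 + L * γ * (B - 1)) * D
        + 1 / 2 * (n * ((L * γ) ^ 2 * (B * (B - 1) / 2 * P))) - 1 / 2 * (1 - L * γ * B) * R) := by
  choose p hp hpT using fun i => hasync1 i t
  set g := L * γ with hgdef
  have hg0 : 0 < g := by positivity
  set U : Fin n → Finset ℕ := fun i => (Finset.Ico t (t + B)).filter (· ∈ T i) with hU
  have hpU : ∀ i, p i ∈ U i := fun i => Finset.mem_filter.2 ⟨hp i, hpT i⟩
  have hUB : ∀ i, (U i).card ≤ B := fun i =>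
    (Finset.card_filter_le _ _).trans (by rw [Nat.card_Ico]; omega)
  set d : Fin n → ℕ → Fin m → ℝ := fun i τ c => gradient f (X i τ) c - gradient f (x t) c with hd
  set S := ∑ τ ∈ Finset.Ico t (t + B), ‖s τ‖ ^ 2 with hS
  set Q := ∑ τ ∈ Finset.Ico (t - B) t, ‖s τ‖ ^ 2 with hQ
  have hS0 : 0 ≤ S := Finset.sum_nonneg fun _ _ => sq_nonneg _
  have hQ0 : 0 ≤ Q := Finset.sum_nonneg fun _ _ => sq_nonneg _
  have herr : ∀ i, ∀ τ ∈ U i, ∑ c, d i τ c ^ 2 ≤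
      g ^ 2 * (((τ : ℝ) - t) * S + ((t : ℝ) + B - 1 - τ) * Q) := by
    intro i τ hτ
    rw [hU, Finset.mem_filter, Finset.mem_Ico] at hτ
    have h1 := sq_norm_view_sub_le_forward hstep hview hτ.2 htB hτ.1.1 hτ.1.2
    have h2 := mul_le_mul_of_nonneg_left h1 (sq_nonneg L)
    refine (sum_sq_gradient_sub_le hLip _ _).trans (h2.trans (le_of_eq ?_))
    rw [hgdef]
    ring
  have hUs : ∀ c, ∀ τ ∈ U (blk c), s τ c = -(gradient f (x t) c + d (blk c) τ c) := by
    intro c τ hτ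
    rw [hU, Finset.mem_filter] at hτ
    rw [hs, if_pos hτ.2, hd]
    ring
  have hs0 : ∀ c, ∀ τ ∈ Finset.Ico t (t + B), τ ∉ U (blk c) → s τ c = 0 := by
    intro c τ hτ hτ2
    rw [hs, if_neg fun h => hτ2 (Finset.mem_filter.2 ⟨hτ, h⟩)]
  have hsum : ∀ c, ∑ τ ∈ Finset.Ico t (t + B), s τ c = ∑ τ ∈ U (blk c), s τ c := fun c =>
    (Finset.sum_subset (Finset.filter_subset _ _) (hs0 c)).symm
  have hsum2 : ∀ c, ∑ τ ∈ Finset.Ico t (t + B), s τ c ^ 2 = ∑ τ ∈ U (blk c), s τ c ^ 2 :=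
    fun c => (Finset.sum_subset (Finset.filter_subset _ _)
      fun τ h1 h2 => by rw [hs0 c τ h1 h2]; norm_num).symm
  have hSU : S = ∑ c, ∑ τ ∈ U (blk c), s τ c ^ 2 := by
    simp_rw [hS, ← sum_sq_eq_norm_sq]
    rw [Finset.sum_comm]
    exact Finset.sum_congr rfl fun c _ => hsum2 c
  refine ⟨∑ c, (∑ τ ∈ U (blk c), s τ c ^ 2 - s (p (blk c)) c ^ 2),
    ∑ c, d (blk c) (p (blk c)) c ^ 2, ?_, Finset.sum_nonneg fun _ _ => sq_nonneg _, ?_, ?_, ?_⟩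
  · refine Finset.sum_nonneg fun c _ => sub_nonneg.2 ?_
    exact Finset.single_le_sum (f := fun τ => s τ c ^ 2) (fun _ _ => sq_nonneg _) (hpU (blk c))
  · refine sum_block_le blk (F := fun i c => d i (p i) c ^ 2) (fun _ _ => sq_nonneg _) fun i => ?_
    refine (herr i (p i) (hpU i)).trans (mul_le_mul_of_nonneg_left ?_ (sq_nonneg g))
    have h1 := Finset.mem_Ico.1 (hp i)
    have h2 : (t : ℝ) ≤ p i := by exact_mod_cast h1.1
    have h3 : (p i : ℝ) + 1 ≤ t + B := by exact_mod_cast h1.2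
    rw [hP, mul_add]
    refine add_le_add (mul_le_mul_of_nonneg_right ?_ hS0) (mul_le_mul_of_nonneg_right ?_ hQ0) <;>
      linarith
  · rw [hSU, ← sum_sq_eq_norm_sq, Finset.mul_sum, Finset.mul_sum, ← Finset.sum_add_distrib,
      ← Finset.sum_add_distrib]
    refine Finset.sum_le_sum fun c _ => ?_
    have := hUs c (p (blk c)) (hpU (blk c))
    rw [this]
    nlinarith [sq_nonneg (gradient f (x t) c - 3 * d (blk c) (p (blk c)) c)]
  · have h1 := le_quadratic_model_of_lipschitz_gradient hdiff hLip (x t)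
      (γ • ∑ τ ∈ Finset.Ico t (t + B), s τ)
    rw [← add_window hstep, norm_smul, Real.norm_of_nonneg hγ.le, inner_smul_right,
      inner_eq_sum_mul, mul_pow, ← sum_sq_eq_norm_sq] at h1
    simp only [WithLp.ofLp_sum, Finset.sum_apply, hsum] at h1
    have h2 := Finset.sum_le_sum fun c (_ : c ∈ Finset.univ) =>
      coordinate_progress (hpU (blk c)) (hUB (blk c)) hg0 hg
        (s := fun τ => s τ c) (d := fun τ => d (blk c) τ c) (hUs c)
    simp only [Finset.sum_add_distrib, Finset.sum_sub_distrib, ← Finset.mul_sum,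
      Finset.sum_neg_distrib] at h2
    rw [sum_sq_eq_norm_sq] at h2
    have h3 : ∑ c, ∑ τ ∈ U (blk c), d (blk c) τ c ^ 2 ≤ n * (g ^ 2 * (B * (B - 1) / 2 * P)) := by
      refine sum_block_le blk (F := fun i c => ∑ τ ∈ U i, d i τ c ^ 2)
        (fun _ _ => Finset.sum_nonneg fun _ _ => sq_nonneg _) fun i => ?_
      rw [Finset.sum_comm]
      refine (Finset.sum_le_sum (herr i)).trans ?_
      refine (Finset.sum_le_sum_of_subset_of_nonneg (Finset.filter_subset _ _)
        fun τ hτ _ => ?_).trans (le_of_eq ?_)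
      · rw [Finset.mem_Ico] at hτ
        have h2 : (t : ℝ) ≤ τ := by exact_mod_cast hτ.1
        have h3 : (τ : ℝ) + 1 ≤ t + B := by exact_mod_cast hτ.2
        refine mul_nonneg (sq_nonneg g) (add_nonneg (mul_nonneg ?_ hS0) (mul_nonneg ?_ hQ0)) <;>
          linarith
      · rw [← Finset.mul_sum, Finset.sum_Ico_eq_sum_range, Nat.add_sub_cancel_left]
        congr 1
        have h4 : ∀ k : ℕ, (((t + k : ℕ) : ℝ) - t) * S + ((t : ℝ) + B - 1 - (t + k : ℕ)) * Q =
            (k : ℝ) * (S - Q) + ((B : ℝ) - 1) * Q := by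
          intro k; push_cast; ring
        simp_rw [h4]
        rw [Finset.sum_add_distrib, ← Finset.sum_mul, sum_range_cast, Finset.sum_const,
          Finset.card_range, nsmul_eq_mul, hP]
        ring
    rw [Finset.sum_sub_distrib]
    have h4 := mul_le_mul_of_nonneg_left h2 hγ.le
    have h5 := mul_le_mul_of_nonneg_left h3 (show 0 ≤ γ * (1 / 2) by positivity)
    simp only [hgdef] at h4 h5 ⊢
    linarith

/-- The error terms of the window following `r + 2 * B` are absorbed by the two windows before. -/
theorem window_recursion (hn : 2 ≤ n) (hB : 1 ≤ B) (hL : 0 < L) (hγ : 0 < γ)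
    (hgz : L * γ * (n * B + B / 2 + 1) ≤ 1) (hdiff : Differentiable ℝ f)
    (hLip : ∀ y z, ‖gradient f z - gradient f y‖ ≤ L * ‖z - y‖)
    (hstep : ∀ t c, x (t + 1) c = x t c + γ * s t c)
    (hview : ∀ i, ∀ t ∈ T i, ∀ c, ∃ σ, σ ≤ t ∧ t < σ + B ∧ X i t c = x σ c)
    (hs : ∀ t c, s t c = if t ∈ T (blk c) then -(gradient f (X (blk c) t) c) else 0)
    (hasync1 : ∀ i t, ∃ t' ∈ Finset.Ico t (t + B), t' ∈ T i) (r : ℕ) {K : ℝ}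
    (hK : L * γ / 2 * n * (B + 1) ≤ K * (1 - L * γ * (B * (n + 1) / 2 + 1))) :
    f (x (r + B + B + B)) ≤ f (x (r + B + B))
      - γ * (1 - L * γ / 2 * (B + 1)) * ‖gradient f (x (r + B + B))‖ ^ 2
      + K * (f (x (r + B)) - f (x (r + B + B))
        + L / 2 * n * B * (γ ^ 2 * ∑ τ ∈ Finset.Ico r (r + B), ‖s τ‖ ^ 2)) := by
  have hn' : (2 : ℝ) ≤ n := by exact_mod_cast hn
  have hB' : (1 : ℝ) ≤ B := by exact_mod_cast hB
  have hB2 : (B : ℝ) = 1 ∨ 2 ≤ (B : ℝ) := by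
    rcases hB.eq_or_lt with h | h
    · left; exact_mod_cast h.symm
    · right; exact_mod_cast h
  have hg : 0 < L * γ := by positivity
  have hnB : (2 : ℝ) ≤ n * B := by nlinarith
  have hdesc := window_descent hB hL hγ hdiff hLip hstep hview hs r
  have hgrad := gradient_sq_le hLip hstep hview hs hasync1 r
  obtain ⟨R, D, hR, -, hD, hS, hprog⟩ := window_progress hL hγ (by nlinarith) hdiff hLip hstep
    hview hs hasync1 (t := r + B + B) (by omega) rfl
  rw [Nat.add_sub_cancel] at hD hprog
  set g := L * γ with hgdef
  have hP1 : 0 ≤ ∑ τ ∈ Finset.Ico (r + B) (r + B + B), ‖s τ‖ ^ 2 :=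
    Finset.sum_nonneg fun _ _ => sq_nonneg _
  have hP2 : 0 ≤ ∑ τ ∈ Finset.Ico r (r + B), ‖s τ‖ ^ 2 := Finset.sum_nonneg fun _ _ => sq_nonneg _
  have hS0 : 0 ≤ ∑ τ ∈ Finset.Ico (r + B + B) (r + B + B + B), ‖s τ‖ ^ 2 :=
    Finset.sum_nonneg fun _ _ => sq_nonneg _
  have herr := window_error_le hn' hB2 hg hgz hP1 hP2 hS0 hR hD hS hgrad
  set P1 := ∑ τ ∈ Finset.Ico (r + B) (r + B + B), ‖s τ‖ ^ 2
  set P2 := ∑ τ ∈ Finset.Ico r (r + B), ‖s τ‖ ^ 2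
  set h := 1 / g - ((B : ℝ) * (n + 1) / 2 + 1) with hh
  have hgh : g * h = 1 - g * (B * (n + 1) / 2 + 1) := by
    rw [hh]
    field_simp
  have hh0 : 0 < h := by
    have : 0 < g * h := by
      rw [hgh]
      nlinarith
    exact pos_of_mul_pos_right this hg.le
  rw [← hgh] at hK
  set G := P1 + (((n : ℝ) + 2) * P1 + (n * B - (B - 1)) * P2) / (2 * h) with hG
  have hnB1 : (0 : ℝ) ≤ n * B - (B - 1) := by nlinarith
  have hG0 : 0 ≤ G := by positivity
  have hΔ : γ * (g * h * G) ≤ f (x (r + B)) - f (x (r + B + B)) + L / 2 * n * B * (γ ^ 2 * P2) := by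
    have e1 : g * h * G = g * h * P1 + g / 2 * ((n + 2) * P1 + (n * B - (B - 1)) * P2) := by
      rw [hG]
      field_simp
    rw [e1, hgh]
    refine le_of_eq_of_le ?_ (add_le_add_left (sub_le_sub_left hdesc (f (x (r + B)))) _)
    rw [hgdef]
    ring
  have hgh0 : 0 < g * h := by positivity
  have hK0 : 0 ≤ K := by
    have : 0 ≤ K * (g * h) := le_trans (by positivity) hK
    exact nonneg_of_mul_nonneg_left this hgh0
  have e1 := mul_le_mul_of_nonneg_left hΔ hK0
  have e2 := mul_le_mul_of_nonneg_right hK (mul_nonneg hγ.le hG0)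
  have e3 := mul_le_mul_of_nonneg_left herr hγ.le
  linarith

end Async

section GradientDescent

variable {F : Type*} [NormedAddCommGroup F] [InnerProductSpace ℝ F] [CompleteSpace F]
  {f : F → ℝ} {L γ : ℝ} {U : Set ℕ} {y : ℕ → F}

/-- One step of gradient descent; `U` is the set of update times. -/
theorem gradient_descent_le (hγ : 0 < γ) (hdiff : Differentiable ℝ f)
    (hLip : ∀ y z, ‖gradient f z - gradient f y‖ ≤ L * ‖z - y‖)
    (hy : ∀ t, y (t + 1) = if t ∈ U then y t - γ • gradient f (y t) else y t)
    {t : ℕ} (ht : t ∈ U) :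
    f (y (t + 1)) ≤ f (y t) - γ * (1 - L * γ / 2) * ‖gradient f (y t)‖ ^ 2 := by
  have h1 := le_quadratic_model_of_lipschitz_gradient hdiff hLip (y t) (-(γ • gradient f (y t)))
  rw [← sub_eq_add_neg, norm_neg, norm_smul, Real.norm_of_nonneg hγ.le, inner_neg_right,
    inner_smul_right, real_inner_self_eq_norm_sq] at h1
  rw [hy, if_pos ht]
  linarith

theorem gradient_descent_antitone (hγ : 0 < γ) (hg : L * γ ≤ 2) (hdiff : Differentiable ℝ f)
    (hLip : ∀ y z, ‖gradient f z - gradient f y‖ ≤ L * ‖z - y‖)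
    (hy : ∀ t, y (t + 1) = if t ∈ U then y t - γ • gradient f (y t) else y t) :
    Antitone fun t => f (y t) := by
  refine antitone_nat_of_succ_le fun t => ?_
  by_cases ht : t ∈ U
  · have h1 := gradient_descent_le hγ hdiff hLip hy ht
    have h2 : 0 ≤ γ * (1 - L * γ / 2) * ‖gradient f (y t)‖ ^ 2 :=
      mul_nonneg (mul_nonneg hγ.le (by linarith)) (sq_nonneg _)
    linarith
  · rw [hy, if_neg ht]

theorem gradient_descent_window {B : ℕ} (hγ : 0 < γ) (hg : L * γ ≤ 2)
    (hdiff : Differentiable ℝ f)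
    (hLip : ∀ y z, ‖gradient f z - gradient f y‖ ≤ L * ‖z - y‖)
    (hy : ∀ t, y (t + 1) = if t ∈ U then y t - γ • gradient f (y t) else y t)
    {t : ℕ} (ht : ∃ t' ∈ Finset.Ico t (t + B), t' ∈ U) :
    f (y (t + B)) ≤ f (y t) - γ * (1 - L * γ / 2) * ‖gradient f (y t)‖ ^ 2 := by
  have hex : ∃ k, t + k ∈ U := by
    obtain ⟨t', h1, h2⟩ := ht
    exact ⟨t' - t, by rwa [Nat.add_sub_cancel' (Finset.mem_Ico.1 h1).1]⟩
  have hidle : ∀ k ≤ Nat.find hex, y (t + k) = y t := by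
    intro k hk
    induction k with
    | zero => rfl
    | succ k ih =>
      rw [← add_assoc, hy, if_neg (Nat.find_min hex hk), ih (by omega)]
  have h1 := gradient_descent_le hγ hdiff hLip hy (Nat.find_spec hex)
  rw [hidle _ le_rfl] at h1
  refine (gradient_descent_antitone hγ hg hdiff hLip hy ?_).trans h1
  obtain ⟨t', h2, h3⟩ := ht
  rw [Finset.mem_Ico] at h2
  have : Nat.find hex ≤ t' - t := Nat.find_min' hex (by rwa [Nat.add_sub_cancel' h2.1])
  omega

end GradientDescent

theorem alpha_recursion_one
    (m n B : ℕ) (hn : 0 < n) (hB : 1 ≤ B)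
    (f : EuclideanSpace ℝ (Fin m) → ℝ) (μ L γ fstar : ℝ)
    (hμ : 0 < μ) (hL : 0 < L) (hγ : 0 < γ)
    (hdiff : Differentiable ℝ f)
    (hmin : ∀ z, fstar ≤ f z) (hattain : ∃ z, f z = fstar)
    (hPL : ∀ z, μ * (f z - fstar) ≤ (1 / 2) * ‖gradient f z‖ ^ 2)
    (hLip : ∀ y z, ‖gradient f z - gradient f y‖ ≤ L * ‖z - y‖)
    (hstatfin : {z : EuclideanSpace ℝ (Fin m) | gradient f z = 0}.Finite)
    (hstatne : {z : EuclideanSpace ℝ (Fin m) | gradient f z = 0}.Nonempty)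
    (blk : Fin m → Fin n) (T : Fin n → Set ℕ) (τ : Fin n → Fin n → ℕ → ℕ)
    (X : Fin n → ℕ → EuclideanSpace ℝ (Fin m))
    (x s : ℕ → EuclideanSpace ℝ (Fin m))
    (hτle : ∀ i j t, τ i j t ≤ t)
    (hread : ∀ i j, j ≠ i → ∀ t c, blk c = j → X i t c = X j (τ i j t) c)
    (hupd : ∀ i t c, blk c = i →
      X i (t + 1) c = if t ∈ T i then X i t c - γ * gradient f (X i t) c else X i t c)
    (hx : ∀ t c, x t c = X (blk c) t c)
    (hs : ∀ t c, s t c = if t ∈ T (blk c) then -(gradient f (X (blk c) t) c) else 0)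
    (hasync1 : ∀ i t, ∃ t' ∈ Finset.Ico t (t + B), t' ∈ T i)
    (hasync2 : ∀ i j t, t ∈ T i → j ≠ i → t < τ i j t + B)
    (alpha beta : ℕ → ℝ)
    (halpha : ∀ t, alpha t = f (x t) - fstar)
    (hbeta : ∀ t, beta t = γ ^ 2 * ∑ τ' ∈ Finset.Ico (t - B) t, ‖s τ'‖ ^ 2)
    (hγmin : γ < min ((2 / L) * (1 / (L * (n : ℝ) ^ 2 * (B : ℝ) + (B : ℝ) + 1))) (1 / (L * ((B : ℝ) / 2) * ((n : ℝ) + 1) + L + (L / 2) * (n : ℝ) * (B : ℝ))))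
    (C1 C2 C3 C4 : ℝ)
    (hC1 : C1 = -μ * (γ ^ 4 * L ^ 2 * (n : ℝ) * (B : ℝ) + γ ^ 2 * (L * (B : ℝ) + L) - 2 * γ))
    (hC2 : C2 = (1 / 2) * (n : ℝ) ^ 2 * (B : ℝ) * γ ^ 4 * L ^ 3 + (1 / 2) * γ ^ 2 * L * (L + 1) * (n : ℝ))
    (hC3 : C3 = (L / 2) * γ ^ 2 * (n : ℝ) * (B : ℝ))
    (hC4 : C4 = γ - γ ^ 2 * L * (((B : ℝ) / 2) * ((n : ℝ) + 1) + 1)) (hC4pos : 0 < C4) :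
    ∀ t : ℕ, 2 * B ≤ t →
      alpha (t + B) ≤ (1 - C1 - (C2 + C3) / C4) * alpha t +
        ((C2 + C3) / C4) * (alpha (t - B) + (L / 2) * (n : ℝ) * (B : ℝ) * beta (t - B)) := by
  have hg : 0 < L * γ := by positivity
  have hn1 : (1 : ℝ) ≤ n := by exact_mod_cast hn
  have hB1 : (1 : ℝ) ≤ B := by exact_mod_cast hB
  have hgz : L * γ * (n * B + B / 2 + 1) ≤ 1 := by
    have h1 := hγmin.trans_le (min_le_right _ _)
    rw [lt_div_iff₀ (by positivity)] at h1
    linarith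
  have hnB : (B : ℝ) ≤ n * B := by nlinarith
  have hgB : L * γ * (B + 1) ≤ 2 := by nlinarith
  have hstep : ∀ t c, x (t + 1) c = x t c + γ * s t c := by
    intro t c
    rw [hx, hx, hs, hupd _ _ _ rfl]
    split_ifs <;> ring
  have hview : ∀ i, ∀ t ∈ T i, ∀ c, ∃ σ, σ ≤ t ∧ t < σ + B ∧ X i t c = x σ c := by
    intro i t ht c
    by_cases hi : blk c = i
    · exact ⟨t, le_rfl, by omega, by rw [hx, hi]⟩
    · exact ⟨τ i (blk c) t, hτle _ _ _, hasync2 _ _ _ ht hi, by rw [hread i _ hi t c rfl, hx]⟩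
  have hC4' : C4 = γ * (1 - L * γ * (B * (n + 1) / 2 + 1)) := by
    rw [hC4]
    ring
  have hC23 : γ * (L * γ / 2 * n * (B + 1)) ≤ C2 + C3 := by
    have h1 : 0 ≤ (1 / 2) * (n : ℝ) ^ 2 * B * γ ^ 4 * L ^ 3 + (1 / 2) * γ ^ 2 * L * L * n := by
      positivity
    rw [hC2, hC3]
    linarith
  intro t ht
  obtain ⟨r, rfl⟩ : ∃ r, t = r + B + B := ⟨t - 2 * B, by omega⟩
  rw [Nat.add_sub_cancel]
  have hK : L * γ / 2 * n * (B + 1) ≤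
      (C2 + C3) / C4 * (1 - L * γ * (B * (n + 1) / 2 + 1)) := by
    refine le_of_mul_le_mul_left (hC23.trans (le_of_eq ?_)) hγ
    rw [mul_left_comm, ← hC4', div_mul_cancel₀ _ hC4pos.ne']
  have hK0 : 0 ≤ (C2 + C3) / C4 :=
    div_nonneg (le_trans (by positivity) hC23) hC4pos.le
  have hmain : f (x (r + B + B + B)) ≤ f (x (r + B + B))
      - γ * (1 - L * γ / 2 * (B + 1)) * ‖gradient f (x (r + B + B))‖ ^ 2
      + (C2 + C3) / C4 * (f (x (r + B)) - f (x (r + B + B))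
        + L / 2 * n * B * (γ ^ 2 * ∑ τ ∈ Finset.Ico r (r + B), ‖s τ‖ ^ 2)) := by
    rcases (show n = 1 ∨ 2 ≤ n by omega) with rfl | hn2
    · have hX : ∀ i t, X i t = x t := by
        intro i t
        ext c
        rw [hx, Subsingleton.elim (blk c) i]
      have hy : ∀ t, x (t + 1) = if t ∈ T 0 then x t - γ • gradient f (x t) else x t := by
        intro t
        ext c
        rw [hstep, hs, hX, Subsingleton.elim (blk c) 0]
        split_ifs <;> simp [sub_eq_add_neg]
      have h1 := gradient_descent_window hγ (by nlinarith) hdiff hLip hy (hasync1 0 (r + B + B))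
      have h2 : f (x (r + B + B)) ≤ f (x (r + B)) :=
        gradient_descent_antitone hγ (by nlinarith) hdiff hLip hy (Nat.le_add_right _ _)
      have h3 : 0 ≤ (C2 + C3) / C4 * (f (x (r + B)) - f (x (r + B + B))
          + L / 2 * (1 : ℕ) * B * (γ ^ 2 * ∑ τ ∈ Finset.Ico r (r + B), ‖s τ‖ ^ 2)) :=
        mul_nonneg hK0 (add_nonneg (sub_nonneg.2 h2) (by positivity))
      have h4 : 0 ≤ γ * (L * γ / 2 * B) * ‖gradient f (x (r + B + B))‖ ^ 2 := by positivity
      linarith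
    · exact window_recursion hn2 hB hL hγ hgz hdiff hLip hstep hview hs hasync1 r hK
  rw [hbeta, Nat.add_sub_cancel, halpha, halpha, halpha, hC1]
  have hα := sub_nonneg.2 (hmin (x (r + B + B)))
  have h1 := mul_le_mul_of_nonneg_left (hPL (x (r + B + B)))
    (show 0 ≤ 2 * (γ * (1 - L * γ / 2 * (B + 1))) from
      mul_nonneg two_pos.le (mul_nonneg hγ.le (by linarith)))
  have h2 : 0 ≤ μ * (γ ^ 4 * L ^ 2 * n * B) * (f (x (r + B + B)) - fstar) :=
    mul_nonneg (by positivity) hα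
  linarith
end

section
/- Suppose γ < min{ (2/L)·1/(Ln²B + B + 1), 1/( L(B/2)(n+1) + L + (L/2)nB ) } (so that C₄ := γ − γ²L((B/2)(n+1) + 1) > 0). Then for all t ≥ 3B, with α(t) = f(x(t)) − f* and β(t) = γ² Σ_{τ=t−B}^{t−1} ‖s(τ)‖², one has α(t+B) ≤ (1 − C₁ − (C₂+C₃)/C₄) α(t) + ((C₂+C₃)/C₄)[ (1 − C₃/C₄) α(t−B) + (C₃/C₄) α(t−2B) + (L/2)nB (C₃/C₄) β(t−2B) ], where C₁ = −μ(γ⁴L²nB + γ²(LB + L) − 2γ), C₂ = (1/2)n²Bγ⁴L³ + (1/2)γ²L(L+1)n, and C₃ = (L/2)γ²nB. -/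
open scoped BigOperators
open Classical

/-- The descent lemma for a function with Lipschitz gradient. -/
lemma le_add_inner_gradient_add_sq {E : Type*} [NormedAddCommGroup E] [InnerProductSpace ℝ E]
    [CompleteSpace E] {f : E → ℝ} {L : ℝ} (hf : Differentiable ℝ f)
    (hLip : ∀ y z, ‖gradient f z - gradient f y‖ ≤ L * ‖z - y‖) (x d : E) :
    f (x + d) ≤ f x + inner ℝ (gradient f x) d + L / 2 * ‖d‖ ^ 2 := by
  have hline : ∀ r : ℝ, HasDerivAt (fun r : ℝ => x + r • d) d r := fun r => by
    simpa using ((hasDerivAt_id r).smul_const d).const_add x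
  have hder : ∀ r : ℝ, HasDerivAt
      (fun r : ℝ => f (x + r • d) - r * inner ℝ (gradient f x) d - L / 2 * r ^ 2 * ‖d‖ ^ 2)
      (inner ℝ (gradient f (x + r • d)) d - inner ℝ (gradient f x) d - L * r * ‖d‖ ^ 2) r := by
    intro r
    have h1 : HasDerivAt (fun r : ℝ => f (x + r • d)) (inner ℝ (gradient f (x + r • d)) d) r :=
      ((hf (x + r • d)).hasGradientAt.hasFDerivAt.comp_hasDerivAt r (hline r)).congr_deriv
        (by simp)
    have h2 := (hasDerivAt_id r).mul_const (inner ℝ (gradient f x) d)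
    have h3 := (((hasDerivAt_id r).pow 2).const_mul (L / 2)).mul_const (‖d‖ ^ 2)
    refine ((h1.sub h2).sub h3).congr_deriv ?_
    simp only [id, Nat.cast_ofNat, Nat.add_one_sub_one, pow_one]
    ring
  have hanti : AntitoneOn
      (fun r : ℝ => f (x + r • d) - r * inner ℝ (gradient f x) d - L / 2 * r ^ 2 * ‖d‖ ^ 2)
      (Set.Icc 0 1) := by
    refine antitoneOn_of_deriv_nonpos (convex_Icc 0 1)
      (fun r _ => (hder r).continuousAt.continuousWithinAt)
      (fun r _ => (hder r).differentiableAt.differentiableWithinAt) fun r hr => ?_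
    rw [interior_Icc] at hr
    rw [(hder r).deriv, ← inner_sub_left]
    have h1 := real_inner_le_norm (gradient f (x + r • d) - gradient f x) d
    have h2 := hLip x (x + r • d)
    rw [add_sub_cancel_left, norm_smul, Real.norm_of_nonneg hr.1.le] at h2
    nlinarith [mul_le_mul_of_nonneg_right h2 (norm_nonneg d)]
  have := hanti (Set.left_mem_Icc.2 zero_le_one) (Set.right_mem_Icc.2 zero_le_one) zero_le_one
  simp only [one_smul, zero_smul, add_zero] at this
  linarith

/-- The trajectories of partially asynchronous block descent along the vector field `F`. -/
structure IsAsyncDescent {m n : ℕ} (F : EuclideanSpace ℝ (Fin m) → EuclideanSpace ℝ (Fin m))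
    (γ : ℝ) (B : ℕ) (blk : Fin m → Fin n) (T : Fin n → Set ℕ) (τ : Fin n → Fin n → ℕ → ℕ)
    (X : Fin n → ℕ → EuclideanSpace ℝ (Fin m)) (x s : ℕ → EuclideanSpace ℝ (Fin m)) : Prop where
  delay_le : ∀ i j t, τ i j t ≤ t
  read : ∀ i j, j ≠ i → ∀ t c, blk c = j → X i t c = X j (τ i j t) c
  update : ∀ i t c, blk c = i →
    X i (t + 1) c = if t ∈ T i then X i t c - γ * F (X i t) c else X i t c
  state : ∀ t c, x t c = X (blk c) t c
  step : ∀ t c, s t c = if t ∈ T (blk c) then -(F (X (blk c) t) c) else 0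
  exists_update : ∀ i t, ∃ t' ∈ Finset.Ico t (t + B), t' ∈ T i
  lt_delay_add : ∀ i j t, t ∈ T i → j ≠ i → t < τ i j t + B

lemma sum_le_sum_of_block_le {m n : ℕ} (blk : Fin m → Fin n) {F : Fin m → ℝ} {e : Fin n → ℝ}
    (h : ∀ i, ∑ c with blk c = i, F c ≤ e i) : ∑ c, F c ≤ ∑ i, e i := by
  rw [← Finset.sum_fiberwise Finset.univ blk F]
  exact Finset.sum_le_sum fun i _ => h i

lemma sum_sum_ite_block_ne {m n : ℕ} (blk : Fin m → Fin n) (F : Fin m → ℝ) :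
    ∑ i, ∑ c, (if blk c ≠ i then F c else 0) = ((n : ℝ) - 1) * ∑ c, F c := by
  rw [Finset.sum_comm, Finset.mul_sum]
  refine Finset.sum_congr rfl fun c _ => ?_
  have h : ∀ i, (if blk c ≠ i then F c else 0) = F c - if blk c = i then F c else 0 := by
    intro i
    split_ifs <;> simp_all
  simp only [h, Finset.sum_sub_distrib]
  simp [sub_mul]

lemma sum_norm_sq_eq_sum_sum_sq {m : ℕ} (s : ℕ → EuclideanSpace ℝ (Fin m)) (I : Finset ℕ) :
    ∑ σ ∈ I, ‖s σ‖ ^ 2 = ∑ c, ∑ σ ∈ I, s σ c ^ 2 := by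
  simp only [EuclideanSpace.real_norm_sq_eq]
  exact Finset.sum_comm

namespace IsAsyncDescent

variable {m n B : ℕ} {F : EuclideanSpace ℝ (Fin m) → EuclideanSpace ℝ (Fin m)} {γ L : ℝ}
  {blk : Fin m → Fin n} {T : Fin n → Set ℕ} {τ : Fin n → Fin n → ℕ → ℕ}
  {X : Fin n → ℕ → EuclideanSpace ℝ (Fin m)} {x s : ℕ → EuclideanSpace ℝ (Fin m)}

lemma state_add_sub (h : IsAsyncDescent F γ B blk T τ X x s) (t k : ℕ) (c : Fin m) :
    x (t + k) c - x t c = γ * ∑ σ ∈ Finset.Ico t (t + k), s σ c := by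
  induction k with
  | zero => simp
  | succ k ih =>
    rw [← add_assoc, Finset.sum_Ico_succ_top (by omega), mul_add, ← ih, h.state (t + k + 1),
      h.update _ _ _ rfl, h.step, h.state (t + k)]
    split_ifs <;> ring

lemma state_add_sub_sq_le (h : IsAsyncDescent F γ B blk T τ X x s) (t k : ℕ) (c : Fin m) :
    (x (t + k) c - x t c) ^ 2 ≤ γ ^ 2 * (k * ∑ σ ∈ Finset.Ico t (t + k), s σ c ^ 2) := by
  rw [h.state_add_sub, mul_pow]
  have := sq_sum_le_card_mul_sum_sq (s := Finset.Ico t (t + k)) (f := fun σ => s σ c)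
  simp only [Nat.card_Ico, add_tsub_cancel_left] at this
  gcongr

lemma norm_state_add_sub_sq_le (h : IsAsyncDescent F γ B blk T τ X x s) (t k : ℕ) :
    ‖x (t + k) - x t‖ ^ 2 ≤ γ ^ 2 * (k * ∑ σ ∈ Finset.Ico t (t + k), ‖s σ‖ ^ 2) := by
  rw [sum_norm_sq_eq_sum_sum_sq, EuclideanSpace.real_norm_sq_eq, Finset.mul_sum, Finset.mul_sum]
  exact Finset.sum_le_sum fun c _ => h.state_add_sub_sq_le t k c

lemma state_add_sub_sq_le_window (h : IsAsyncDescent F γ B blk T τ X x s) (t : ℕ) {k l N : ℕ}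
    (hk : k ≤ l) (hN : k ≤ N) (c : Fin m) :
    (x (t + k) c - x t c) ^ 2 ≤ γ ^ 2 * (l * ∑ σ ∈ Finset.Ico t (t + N), s σ c ^ 2) := by
  refine (h.state_add_sub_sq_le t k c).trans ?_
  have : Finset.Ico t (t + k) ⊆ Finset.Ico t (t + N) := Finset.Ico_subset_Ico le_rfl (by omega)
  gcongr

/-- The error in the foreign coordinates of the vector a processor updates with. -/
lemma read_sub_sq_le (h : IsAsyncDescent F γ B blk T τ X x s) {t k : ℕ} (ht : B ≤ t) (hk : k < B)
    {i : Fin n} (hi : t + k ∈ T i) {c : Fin m} (hc : blk c ≠ i) :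
    (X i (t + k) c - x t c) ^ 2 ≤ γ ^ 2 * (k * ∑ σ ∈ Finset.Ico t (t + B), s σ c ^ 2 +
      ((B : ℝ) - 1 - k) * ∑ σ ∈ Finset.Ico (t - B) t, s σ c ^ 2) := by
  have hkB : (0 : ℝ) ≤ (B : ℝ) - 1 - k := by
    have : (k : ℝ) + 1 ≤ B := by exact_mod_cast hk
    linarith
  have hW : (0 : ℝ) ≤ ∑ σ ∈ Finset.Ico t (t + B), s σ c ^ 2 :=
    Finset.sum_nonneg fun _ _ => sq_nonneg _
  have hA : (0 : ℝ) ≤ ∑ σ ∈ Finset.Ico (t - B) t, s σ c ^ 2 :=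
    Finset.sum_nonneg fun _ _ => sq_nonneg _
  rw [h.read i (blk c) hc _ c rfl, ← h.state]
  have h1 := h.delay_le i (blk c) (t + k)
  have h2 := h.lt_delay_add i (blk c) _ hi hc
  generalize τ i (blk c) (t + k) = r at h1 h2
  rcases le_total t r with hr | hr
  · obtain ⟨d, rfl⟩ := Nat.exists_eq_add_of_le hr
    refine (h.state_add_sub_sq_le_window t (l := k) (N := B) (by omega) (by omega) c).trans ?_
    gcongr
    nlinarith
  · obtain ⟨d, rfl⟩ := Nat.exists_eq_add_of_le hr
    rw [← neg_sub, neg_sq]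
    refine (h.state_add_sub_sq_le r d c).trans ?_
    have hd : (d : ℝ) ≤ (B : ℝ) - 1 - k := by
      have : d + 1 + k ≤ B := by omega
      have : (d : ℝ) + 1 + k ≤ B := by exact_mod_cast this
      linarith
    have hsub : Finset.Ico r (r + d) ⊆ Finset.Ico (r + d - B) (r + d) :=
      Finset.Ico_subset_Ico (by omega) le_rfl
    have h3 : (d : ℝ) * ∑ σ ∈ Finset.Ico r (r + d), s σ c ^ 2 ≤
        ((B : ℝ) - 1 - k) * ∑ σ ∈ Finset.Ico (r + d - B) (r + d), s σ c ^ 2 := by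
      gcongr
    have : (0 : ℝ) ≤ k * ∑ σ ∈ Finset.Ico (r + d) (r + d + B), s σ c ^ 2 := by positivity
    gcongr
    linarith

/-- The error of the vector a processor updates with. -/
lemma norm_read_sub_sq_le (h : IsAsyncDescent F γ B blk T τ X x s) {t k : ℕ} (ht : B ≤ t)
    (hk : k < B) {i : Fin n} (hi : t + k ∈ T i) :
    ‖X i (t + k) - x t‖ ^ 2 ≤ γ ^ 2 * (k * ∑ σ ∈ Finset.Ico t (t + B), ‖s σ‖ ^ 2 +
      ((B : ℝ) - 1 - k) * ∑ c, if blk c ≠ i then ∑ σ ∈ Finset.Ico (t - B) t, s σ c ^ 2 else 0) := by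
  rw [sum_norm_sq_eq_sum_sum_sq, EuclideanSpace.real_norm_sq_eq, Finset.mul_sum, Finset.mul_sum,
    ← Finset.sum_add_distrib, Finset.mul_sum]
  refine Finset.sum_le_sum fun c _ => ?_
  rw [PiLp.sub_apply]
  split_ifs with hc
  · exact h.read_sub_sq_le ht hk hi hc
  · have hc : blk c = i := not_not.1 hc
    rw [← hc, ← h.state]
    simpa using h.state_add_sub_sq_le_window t (le_refl k) hk.le c

/-- The error of the vector a processor updates with at its first update after time `t`. -/
lemma norm_read_sub_sq_le_of_first (h : IsAsyncDescent F γ B blk T τ X x s) {t k : ℕ} (ht : B ≤ t)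
    (hk : k < B) {i : Fin n} (hi : t + k ∈ T i) (hfirst : ∀ l < k, t + l ∉ T i) :
    ‖X i (t + k) - x t‖ ^ 2 ≤ γ ^ 2 * (((B : ℝ) - 1) * ∑ c, if blk c ≠ i then
      (∑ σ ∈ Finset.Ico t (t + B), s σ c ^ 2 + ∑ σ ∈ Finset.Ico (t - B) t, s σ c ^ 2) else 0) := by
  rw [EuclideanSpace.real_norm_sq_eq, Finset.mul_sum, Finset.mul_sum]
  refine Finset.sum_le_sum fun c _ => ?_
  rw [PiLp.sub_apply]
  split_ifs with hc
  · refine (h.read_sub_sq_le ht hk hi hc).trans ?_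
    have hW : (0 : ℝ) ≤ ∑ σ ∈ Finset.Ico t (t + B), s σ c ^ 2 :=
      Finset.sum_nonneg fun _ _ => sq_nonneg _
    have hA : (0 : ℝ) ≤ ∑ σ ∈ Finset.Ico (t - B) t, s σ c ^ 2 :=
      Finset.sum_nonneg fun _ _ => sq_nonneg _
    have hkB : (k : ℝ) + 1 ≤ B := by exact_mod_cast hk
    have hk0 : (0 : ℝ) ≤ k := k.cast_nonneg
    gcongr
    nlinarith
  · have hc : blk c = i := not_not.1 hc
    rw [← hc, ← h.state, h.state_add_sub, Finset.sum_eq_zero]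
    · simp
    · intro σ hσ
      rw [Finset.mem_Ico] at hσ
      obtain ⟨l, rfl⟩ := Nat.exists_eq_add_of_le hσ.1
      rw [h.step, if_neg (hc ▸ hfirst l (by omega))]

lemma sum_block_sub_sq_le (hLip : ∀ y z, ‖F z - F y‖ ≤ L * ‖z - y‖)
    (y z : EuclideanSpace ℝ (Fin m)) (I : Finset (Fin m)) :
    ∑ c ∈ I, (F z c - F y c) ^ 2 ≤ L ^ 2 * ‖z - y‖ ^ 2 := by
  calc ∑ c ∈ I, (F z c - F y c) ^ 2
      ≤ ∑ c, (F z c - F y c) ^ 2 :=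
        Finset.sum_le_sum_of_subset_of_nonneg (Finset.subset_univ _) fun _ _ _ => sq_nonneg _
    _ = ‖F z - F y‖ ^ 2 := by rw [EuclideanSpace.real_norm_sq_eq]; rfl
    _ ≤ (L * ‖z - y‖) ^ 2 := by gcongr; exact hLip y z
    _ = L ^ 2 * ‖z - y‖ ^ 2 := mul_pow ..

/-- The total error of the gradients used at time `t + k`. -/
lemma sum_update_error_le (h : IsAsyncDescent F γ B blk T τ X x s)
    (hLip : ∀ y z, ‖F z - F y‖ ≤ L * ‖z - y‖) {t k : ℕ} (ht : B ≤ t) (hk : k < B) :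
    ∑ c, (if t + k ∈ T (blk c) then (F (X (blk c) (t + k)) c - F (x t) c) ^ 2 else 0) ≤
      (L * γ) ^ 2 * (k * (n * ∑ σ ∈ Finset.Ico t (t + B), ‖s σ‖ ^ 2) +
        ((B : ℝ) - 1 - k) * (((n : ℝ) - 1) * ∑ σ ∈ Finset.Ico (t - B) t, ‖s σ‖ ^ 2)) := by
  have hkB : (0 : ℝ) ≤ (B : ℝ) - 1 - k := by
    have : (k : ℝ) + 1 ≤ B := by exact_mod_cast hk
    linarith
  have key : ∀ i, ∑ c with blk c = i,
      (if t + k ∈ T (blk c) then (F (X (blk c) (t + k)) c - F (x t) c) ^ 2 else 0) ≤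
      (L * γ) ^ 2 * (k * ∑ σ ∈ Finset.Ico t (t + B), ‖s σ‖ ^ 2 + ((B : ℝ) - 1 - k) *
        ∑ c, if blk c ≠ i then ∑ σ ∈ Finset.Ico (t - B) t, s σ c ^ 2 else 0) := by
    intro i
    by_cases hi : t + k ∈ T i
    · calc _ = ∑ c with blk c = i, (F (X i (t + k)) c - F (x t) c) ^ 2 := by
            refine Finset.sum_congr rfl fun c hc => ?_
            rw [(Finset.mem_filter.1 hc).2, if_pos hi]
        _ ≤ L ^ 2 * ‖X i (t + k) - x t‖ ^ 2 := sum_block_sub_sq_le hLip _ _ _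
        _ ≤ L ^ 2 * _ := mul_le_mul_of_nonneg_left (h.norm_read_sub_sq_le ht hk hi) (sq_nonneg L)
        _ = _ := by ring
    · rw [Finset.sum_eq_zero]
      · have : (0 : ℝ) ≤
            ∑ c, if blk c ≠ i then ∑ σ ∈ Finset.Ico (t - B) t, s σ c ^ 2 else 0 :=
          Finset.sum_nonneg fun c _ => by split_ifs <;> positivity
        positivity
      · intro c hc
        rw [(Finset.mem_filter.1 hc).2, if_neg hi]
  refine (sum_le_sum_of_block_le blk key).trans_eq ?_
  rw [← Finset.mul_sum, Finset.sum_add_distrib, ← Finset.mul_sum, ← Finset.mul_sum,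
    sum_sum_ite_block_ne, ← sum_norm_sq_eq_sum_sum_sq]
  simp

/-- Every window of length `B` moves along almost a full gradient step. -/
lemma norm_sq_le_window (h : IsAsyncDescent F γ B blk T τ X x s)
    (hLip : ∀ y z, ‖F z - F y‖ ≤ L * ‖z - y‖) {t : ℕ} (ht : B ≤ t) {ε : ℝ} (hε : 0 < ε) :
    ‖F (x t)‖ ^ 2 ≤ (1 + ε) * ∑ σ ∈ Finset.Ico t (t + B), ‖s σ‖ ^ 2 +
      (1 + 1 / ε) * ((L * γ) ^ 2 * (((n : ℝ) - 1) * ((B : ℝ) - 1) *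
        (∑ σ ∈ Finset.Ico t (t + B), ‖s σ‖ ^ 2 + ∑ σ ∈ Finset.Ico (t - B) t, ‖s σ‖ ^ 2))) := by
  have hex : ∀ i, ∃ k, k < B ∧ t + k ∈ T i ∧ ∀ l < k, t + l ∉ T i := by
    intro i
    obtain ⟨t', ht', hi⟩ := h.exists_update i t
    rw [Finset.mem_Ico] at ht'
    have hne : ∃ k, t + k ∈ T i := ⟨t' - t, by rwa [Nat.add_sub_cancel' ht'.1]⟩
    refine ⟨Nat.find hne, ?_, Nat.find_spec hne, fun l hl => Nat.find_min hne hl⟩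
    have := Nat.find_min' hne (m := t' - t) (by rwa [Nat.add_sub_cancel' ht'.1])
    omega
  choose k hkB hkT hkfirst using hex
  have hp : ∑ c, F (X (blk c) (t + k (blk c))) c ^ 2 ≤
      ∑ σ ∈ Finset.Ico t (t + B), ‖s σ‖ ^ 2 := by
    rw [sum_norm_sq_eq_sum_sum_sq]
    refine Finset.sum_le_sum fun c _ => ?_
    have := Finset.single_le_sum (f := fun σ => s σ c ^ 2) (s := Finset.Ico t (t + B))
      (fun _ _ => sq_nonneg _) (Finset.mem_Ico.2 ⟨Nat.le_add_right t (k (blk c)),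
        Nat.add_lt_add_left (hkB (blk c)) t⟩)
    simpa [h.step, hkT] using this
  have he : ∑ c, (F (X (blk c) (t + k (blk c))) c - F (x t) c) ^ 2 ≤
      (L * γ) ^ 2 * (((n : ℝ) - 1) * ((B : ℝ) - 1) *
        (∑ σ ∈ Finset.Ico t (t + B), ‖s σ‖ ^ 2 + ∑ σ ∈ Finset.Ico (t - B) t, ‖s σ‖ ^ 2)) := by
    have key : ∀ i, ∑ c with blk c = i, (F (X (blk c) (t + k (blk c))) c - F (x t) c) ^ 2 ≤
        (L * γ) ^ 2 * (((B : ℝ) - 1) * ∑ c, if blk c ≠ i then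
          (∑ σ ∈ Finset.Ico t (t + B), s σ c ^ 2 + ∑ σ ∈ Finset.Ico (t - B) t, s σ c ^ 2)
          else 0) := by
      intro i
      calc _ = ∑ c with blk c = i, (F (X i (t + k i)) c - F (x t) c) ^ 2 := by
            refine Finset.sum_congr rfl fun c hc => ?_
            rw [(Finset.mem_filter.1 hc).2]
        _ ≤ L ^ 2 * ‖X i (t + k i) - x t‖ ^ 2 := sum_block_sub_sq_le hLip _ _ _
        _ ≤ L ^ 2 * _ := mul_le_mul_of_nonneg_left
            (h.norm_read_sub_sq_le_of_first ht (hkB i) (hkT i) (hkfirst i)) (sq_nonneg L)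
        _ = _ := by ring
    refine (sum_le_sum_of_block_le blk key).trans_eq ?_
    rw [← Finset.mul_sum, ← Finset.mul_sum, sum_sum_ite_block_ne, Finset.sum_add_distrib,
      ← sum_norm_sq_eq_sum_sum_sq, ← sum_norm_sq_eq_sum_sum_sq]
    ring
  have hyoung : ‖F (x t)‖ ^ 2 ≤ (1 + ε) * ∑ c, F (X (blk c) (t + k (blk c))) c ^ 2 +
      (1 + 1 / ε) * ∑ c, (F (X (blk c) (t + k (blk c))) c - F (x t) c) ^ 2 := by
    rw [EuclideanSpace.real_norm_sq_eq, Finset.mul_sum, Finset.mul_sum, ← Finset.sum_add_distrib]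
    refine Finset.sum_le_sum fun c _ => ?_
    generalize F (X (blk c) (t + k (blk c))) c = p
    generalize F (x t) c = g
    have : (1 + ε) * p ^ 2 + (1 + 1 / ε) * (p - g) ^ 2 - g ^ 2 = (ε * p + (p - g)) ^ 2 / ε := by
      field_simp
      ring
    nlinarith [div_nonneg (sq_nonneg (ε * p + (p - g))) hε.le]
  refine hyoung.trans ?_
  gcongr

end IsAsyncDescent

lemma sum_range_weighted (B : ℕ) (P Q : ℝ) :
    ∑ k ∈ Finset.range B, ((k : ℝ) * P + ((B : ℝ) - 1 - k) * Q) =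
      (B : ℝ) * ((B : ℝ) - 1) / 2 * (P + Q) := by
  have hid : ∀ N : ℕ, ∑ k ∈ Finset.range N, (k : ℝ) = (N : ℝ) * ((N : ℝ) - 1) / 2 := by
    intro N
    induction N with
    | zero => simp
    | succ N ih => rw [Finset.sum_range_succ, ih]; push_cast; ring
  simp only [Finset.sum_add_distrib, ← Finset.sum_mul, Finset.sum_sub_distrib, hid]
  simp
  ring

namespace IsAsyncDescent

variable {m n B : ℕ} {f : EuclideanSpace ℝ (Fin m) → ℝ} {γ L : ℝ}
  {blk : Fin m → Fin n} {T : Fin n → Set ℕ} {τ : Fin n → Fin n → ℕ → ℕ}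
  {X : Fin n → ℕ → EuclideanSpace ℝ (Fin m)} {x s : ℕ → EuclideanSpace ℝ (Fin m)}

/-- The decrease of the objective over a window of length `B`. -/
lemma window_decrease (h : IsAsyncDescent (gradient f) γ B blk T τ X x s)
    (hf : Differentiable ℝ f) (hL : 0 ≤ L) (hγ : 0 ≤ γ)
    (hLip : ∀ y z, ‖gradient f z - gradient f y‖ ≤ L * ‖z - y‖) {t : ℕ} (ht : B ≤ t) :
    γ / 2 * (‖gradient f (x t)‖ ^ 2 + (1 - L * γ * B - (L * γ) ^ 2 * n * B * ((B : ℝ) - 1) / 2) *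
        ∑ σ ∈ Finset.Ico t (t + B), ‖s σ‖ ^ 2 -
      (L * γ) ^ 2 * ((n : ℝ) - 1) * B * ((B : ℝ) - 1) / 2 *
        ∑ σ ∈ Finset.Ico (t - B) t, ‖s σ‖ ^ 2) ≤ f (x t) - f (x (t + B)) := by
  set g := gradient f (x t)
  set W := ∑ σ ∈ Finset.Ico t (t + B), ‖s σ‖ ^ 2 with hW
  set A := ∑ σ ∈ Finset.Ico (t - B) t, ‖s σ‖ ^ 2 with hA
  have hdesc := le_add_inner_gradient_add_sq hf hLip (x t) (x (t + B) - x t)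
  rw [add_sub_cancel] at hdesc
  have hU := h.norm_state_add_sub_sq_le t B
  have hinner : inner ℝ g (x (t + B) - x t) =
      γ * ∑ c, ∑ σ ∈ Finset.Ico t (t + B), g c * s σ c := by
    rw [PiLp.inner_apply, Finset.mul_sum]
    refine Finset.sum_congr rfl fun c _ => ?_
    rw [PiLp.sub_apply, h.state_add_sub, ← Finset.mul_sum]
    simp
    ring
  have hcoord : ∀ c, ∑ σ ∈ Finset.Ico t (t + B), g c * s σ c ≤
      -(g c ^ 2 / 2) - (∑ σ ∈ Finset.Ico t (t + B), s σ c ^ 2) / 2 + (∑ σ ∈ Finset.Ico t (t + B),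
        if σ ∈ T (blk c) then (gradient f (X (blk c) σ) c - g c) ^ 2 else 0) / 2 := by
    intro c
    have hone : g c ^ 2 / 2 ≤
        ∑ σ ∈ Finset.Ico t (t + B), if σ ∈ T (blk c) then g c ^ 2 / 2 else 0 := by
      obtain ⟨σ, hσ, hσT⟩ := h.exists_update (blk c) t
      have := Finset.single_le_sum (f := fun σ => if σ ∈ T (blk c) then g c ^ 2 / 2 else 0)
        (fun _ _ => by dsimp only; split_ifs <;> positivity) hσ
      simpa [hσT] using this
    have hterm : ∑ σ ∈ Finset.Ico t (t + B), g c * s σ c =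
        ∑ σ ∈ Finset.Ico t (t + B), (-(if σ ∈ T (blk c) then g c ^ 2 / 2 else 0) - s σ c ^ 2 / 2 +
          (if σ ∈ T (blk c) then (gradient f (X (blk c) σ) c - g c) ^ 2 else 0) / 2) := by
      refine Finset.sum_congr rfl fun σ _ => ?_
      rw [h.step]
      split_ifs <;> ring
    rw [hterm, Finset.sum_add_distrib, Finset.sum_sub_distrib, Finset.sum_neg_distrib,
      ← Finset.sum_div, ← Finset.sum_div]
    linarith
  have herr : ∑ c, ∑ σ ∈ Finset.Ico t (t + B),
      (if σ ∈ T (blk c) then (gradient f (X (blk c) σ) c - g c) ^ 2 else 0) ≤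
      (L * γ) ^ 2 * ((B : ℝ) * ((B : ℝ) - 1) / 2 * (n * W + ((n : ℝ) - 1) * A)) := by
    rw [Finset.sum_comm, Finset.sum_Ico_eq_sum_range, add_tsub_cancel_left, ← sum_range_weighted,
      Finset.mul_sum]
    exact Finset.sum_le_sum fun k hk =>
      h.sum_update_error_le hLip ht (Finset.mem_range.1 hk)
  have hsum := Finset.sum_le_sum fun c (_ : c ∈ Finset.univ) => hcoord c
  rw [Finset.sum_add_distrib, Finset.sum_sub_distrib, Finset.sum_neg_distrib, ← Finset.sum_div,
    ← Finset.sum_div, ← Finset.sum_div, ← sum_norm_sq_eq_sum_sum_sq, ← hW,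
    ← EuclideanSpace.real_norm_sq_eq] at hsum
  have hmain : γ * ∑ c, ∑ σ ∈ Finset.Ico t (t + B), g c * s σ c ≤ γ * (-(‖g‖ ^ 2 / 2) - W / 2 +
      (L * γ) ^ 2 * ((B : ℝ) * ((B : ℝ) - 1) / 2 * (n * W + ((n : ℝ) - 1) * A)) / 2) := by
    gcongr
    linarith
  have hquad : L / 2 * ‖x (t + B) - x t‖ ^ 2 ≤ L / 2 * (γ ^ 2 * (B * W)) := by gcongr
  rw [hinner] at hdesc
  linarith

/-- The gradient changes little over a window of length `B`. -/
lemma norm_gradient_sq_le_previous (h : IsAsyncDescent (gradient f) γ B blk T τ X x s)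
    (hLip : ∀ y z, ‖gradient f z - gradient f y‖ ≤ L * ‖z - y‖) {t : ℕ} (ht : B ≤ t) :
    ‖gradient f (x t)‖ ^ 2 ≤ 3 / 2 * ‖gradient f (x (t - B))‖ ^ 2 +
      3 * (L * γ) ^ 2 * B * ∑ σ ∈ Finset.Ico (t - B) t, ‖s σ‖ ^ 2 := by
  have hU := h.norm_state_add_sub_sq_le (t - B) B
  have hd := hLip (x (t - B)) (x t)
  rw [Nat.sub_add_cancel ht] at hU
  have htri : ‖gradient f (x t)‖ ≤ ‖gradient f (x (t - B))‖ + L * ‖x t - x (t - B)‖ := by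
    have := norm_le_norm_add_norm_sub' (gradient f (x t)) (gradient f (x (t - B)))
    linarith
  calc ‖gradient f (x t)‖ ^ 2
      ≤ (‖gradient f (x (t - B))‖ + L * ‖x t - x (t - B)‖) ^ 2 := by gcongr
    _ ≤ 3 / 2 * ‖gradient f (x (t - B))‖ ^ 2 + 3 * L ^ 2 * ‖x t - x (t - B)‖ ^ 2 := by
        nlinarith [sq_nonneg (‖gradient f (x (t - B))‖ - 2 * (L * ‖x t - x (t - B)‖))]
    _ ≤ 3 / 2 * ‖gradient f (x (t - B))‖ ^ 2 + 3 * L ^ 2 *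
        (γ ^ 2 * (B * ∑ σ ∈ Finset.Ico (t - B) t, ‖s σ‖ ^ 2)) := by gcongr
    _ = _ := by ring

end IsAsyncDescent

/-- The coefficient of the oldest window sum is absorbed under the stepsize bound. -/
lemma foreign_delay_coeff_le {n B h : ℝ} (hn : 1 ≤ n) (hB : 1 ≤ B) (hh : 0 ≤ h)
    (hs : h * (n * B + B / 2 + 1) ≤ 1) :
    h * (n - 1) * (B - 1) ≤ n * (1 - h * B - h ^ 2 * n * B * (B - 1) / 2) := by
  obtain ⟨y, hy⟩ : ∃ y, y = h * B := ⟨_, rfl⟩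
  have hy0 : 0 ≤ y := by rw [hy]; positivity
  have hyn : y * (2 * n + 1) ≤ 2 := by nlinarith
  have h1 : h * (n - 1) * (B - 1) ≤ (n - 1) * y := by nlinarith [mul_nonneg hh (sub_nonneg.2 hn)]
  have h2 : h ^ 2 * n * B * (B - 1) ≤ n * y ^ 2 := by
    have : 0 ≤ h ^ 2 * n * B := by positivity
    nlinarith
  have h3 : 2 * n * y - y + n ^ 2 * y ^ 2 / 2 ≤ n := by
    have e1 : (2 * n * y - y + n ^ 2 * y ^ 2 / 2) * (2 * n + 1) ^ 2 ≤ n * (2 * n + 1) ^ 2 := by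
      have : (y * (2 * n + 1)) ^ 2 ≤ 4 := by
        nlinarith [mul_nonneg hy0 (by linarith : 0 ≤ 2 * n + 1)]
      have a : (2 * n - 1) * (2 * n + 1) * (y * (2 * n + 1)) ≤ (2 * n - 1) * (2 * n + 1) * 2 := by
        apply mul_le_mul_of_nonneg_left hyn; nlinarith
      have b : n ^ 2 / 2 * (y * (2 * n + 1)) ^ 2 ≤ n ^ 2 / 2 * 4 := by gcongr
      nlinarith [mul_nonneg (sub_nonneg.2 hn) (sub_nonneg.2 hn),
        mul_nonneg (mul_nonneg (sub_nonneg.2 hn) (sub_nonneg.2 hn)) (sub_nonneg.2 hn)]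
    exact le_of_mul_le_mul_right e1 (by positivity)
  nlinarith

/-- The single-block case of the stepsize condition, without foreign coordinates. -/
lemma one_block_coeff_le {B h : ℝ} (hB : 1 ≤ B) (hh : 0 ≤ h)
    (hs : h * (B + B / 2 + 1) ≤ 1) :
    2 * h ^ 2 * B ≤ 1 - h * B - h ^ 2 * B * (B - 1) / 2 := by
  obtain ⟨y, hy⟩ : ∃ y, y = h * B := ⟨_, rfl⟩
  have hy1 : y ≤ 2 / 3 * (1 - h) := by rw [hy]; linarith
  have hy0 : 0 ≤ y := by rw [hy]; positivity
  have : h ^ 2 * B * (B - 1) = y * (y - h) := by rw [hy]; ring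
  have : h ^ 2 * B = h * y := by rw [hy]; ring
  nlinarith [mul_nonneg hy0 hh, mul_nonneg hh (sub_nonneg.2 hy1), mul_nonneg hy0 (sub_nonneg.2 hy1)]

/-- The coefficient of the current window sum, for at least two blocks. -/
lemma current_window_coeff_le {n B h : ℝ} (hn : 2 ≤ n) (hB : 1 ≤ B) (hh : 0 ≤ h) :
    (1 - h * B - 2 * (h * (3 + n * (B + 1)) / 6)) * (1 + h * (3 + n * (B + 1)) / 6) ^ 2 ≤
      1 - h * B - h ^ 2 * n * B * (B - 1) / 2 := by
  obtain ⟨T, hT⟩ : ∃ T, T = (3 + n * (B + 1)) / 6 := ⟨_, rfl⟩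
  have hT0 : 0 ≤ T := by rw [hT]; positivity
  have key : n * B * (B - 1) / 2 ≤ 3 * T ^ 2 + 2 * B * T := by
    rw [hT]
    nlinarith [mul_nonneg (sub_nonneg.2 hn) (sub_nonneg.2 hB),
      mul_nonneg (by linarith : 0 ≤ n) (mul_nonneg (sub_nonneg.2 hn) (sq_nonneg (B + 1)))]
  have : h * (3 + n * (B + 1)) / 6 = h * T := by rw [hT]; ring
  rw [this]
  have := mul_le_mul_of_nonneg_left key (sq_nonneg h)
  have h3 : 0 ≤ h ^ 3 * T ^ 3 := by positivity
  have h4 : 0 ≤ h ^ 3 * T ^ 2 * B := by positivity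
  nlinarith

/-- A concave quadratic is nonnegative between `0` and `1 / D` if it is so at the endpoints. -/
lemma nonneg_of_concave_quadratic {a b c D h : ℝ} (hD : 0 < D) (hh : 0 ≤ h)
    (hs : h * D ≤ 1) (ha : 0 ≤ a) (hc : 0 ≤ c) (hend : 0 ≤ a * D ^ 2 + b * D - c) :
    0 ≤ a + b * h - c * h ^ 2 := by
  have h1 : 0 ≤ 1 - h * D := by linarith
  refine nonneg_of_mul_nonneg_right (?_ : 0 ≤ D * _) hD
  have h2 : 0 ≤ (1 - h * D) * (D * a + h * c) := by positivity
  nlinarith [mul_nonneg hh hend]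

/-- The coefficient of the previous window sum, for at least two blocks. -/
lemma previous_window_coeff_le {n B h : ℝ} (hn : 2 ≤ n) (hB : 1 ≤ B) (hh : 0 ≤ h)
    (hs : h * (n * B + B / 2 + 1) ≤ 1) :
    h * (3 + n * (B + 1)) / 6 * (1 - h * (3 + n * (B + 1)) / 6 - h * B) ≤
      h * n * (B + 1) / 2 * (1 - h * B - h ^ 2 * n * B * (B - 1) / 2 - 2 * h ^ 2 * B) -
        h ^ 2 * (n - 1) * B * (B - 1) / 2 := by
  obtain ⟨u, rfl⟩ : ∃ u, n = 2 + u := ⟨n - 2, by ring⟩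
  obtain ⟨v, rfl⟩ : ∃ v, B = 1 + v := ⟨B - 1, by ring⟩
  have hu : 0 ≤ u := by linarith
  have hv : 0 ≤ v := by linarith
  obtain ⟨Y, hY⟩ : ∃ Y, Y = (2 + u) * (1 + v + 1) := ⟨_, rfl⟩
  have := nonneg_of_concave_quadratic (a := Y / 3 - 1 / 2)
    (b := -(Y / 2 * (1 + v)) - (u + 1) * (1 + v) * v / 2 + (3 + Y) / 6 * (1 + v + (3 + Y) / 6))
    (c := Y / 2 * ((2 + u) * (1 + v) * v / 2 + 2 * (1 + v)))
    (by positivity) hh hs (by rw [hY]; nlinarith [mul_nonneg hu hv]) (by rw [hY]; positivity)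
    (by rw [hY]; ring_nf; positivity)
  have := mul_nonneg hh this
  rw [hY] at this
  nlinarith

lemma sub_one_mul_sub_one_le {n B : ℝ} (hn : 1 ≤ n) (hB : 1 ≤ B) :
    (n - 1) * (B - 1) ≤ ((3 + n * (B + 1)) / 6) ^ 2 := by
  obtain ⟨p, rfl⟩ : ∃ p, n = p + 1 := ⟨n - 1, by ring⟩
  obtain ⟨b, rfl⟩ : ∃ b, B = b + 1 := ⟨B - 1, by ring⟩
  have hp : 0 ≤ p := by linarith
  have hb : 0 ≤ b := by linarith
  obtain ⟨S, hS⟩ : ∃ S, S = 2 * p + b := ⟨_, rfl⟩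
  obtain ⟨u, hu⟩ : ∃ u, u = p * b := ⟨_, rfl⟩
  have hS0 : 0 ≤ S := by rw [hS]; positivity
  have hu0 : 0 ≤ u := by rw [hu]; positivity
  have hSu : 8 * u ≤ S ^ 2 := by rw [hS, hu]; nlinarith [sq_nonneg (2 * p - b)]
  have hcross : 4 * u ≤ S * (5 + u) := by
    rcases le_total 4 S with h | h <;> nlinarith
  have : 3 + (p + 1) * (b + 1 + 1) = 5 + u + S := by rw [hS, hu]; ring
  rw [this, add_sub_cancel_right, add_sub_cancel_right, ← hu]
  nlinarith [sq_nonneg (u - 5)]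

/-- The squared gradient is dominated by the decrease of two consecutive windows. -/
lemma gradient_sq_le_combination {n : ℕ} {B h G P W A : ℝ} (hn : 1 ≤ n) (hB : 1 ≤ B) (hh : 0 < h)
    (hs : h * (n * B + B / 2 + 1) ≤ 1) (hG : 0 ≤ G) (hW : 0 ≤ W) (hA : 0 ≤ A)
    (hwin : ∀ ε : ℝ, 0 < ε → G ≤ (1 + ε) * W +
      (1 + 1 / ε) * (h ^ 2 * (((n : ℝ) - 1) * (B - 1) * (W + A))))
    (hprev : G ≤ 3 / 2 * P + 3 * h ^ 2 * B * A) :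
    G ≤ h * (B + 1) * G + h * n * (B + 1) / 2 * P +
      (1 - h * B - h ^ 2 * n * B * (B - 1) / 2) * W +
      (h * n * (B + 1) / 2 * (1 - h * B - h ^ 2 * n * B * (B - 1) / 2) -
        h ^ 2 * ((n : ℝ) - 1) * B * (B - 1) / 2) * A := by
  have hnr : (1 : ℝ) ≤ n := by exact_mod_cast hn
  have hθ := foreign_delay_coeff_le hnr hB hh.le hs
  have hθ0 : 0 ≤ 1 - h * B - h ^ 2 * n * B * (B - 1) / 2 := by
    have : 0 ≤ h * ((n : ℝ) - 1) * (B - 1) :=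
      mul_nonneg (mul_nonneg hh.le (by linarith)) (by linarith)
    exact nonneg_of_mul_nonneg_right (this.trans hθ) (by linarith)
  have hp := mul_le_mul_of_nonneg_left hprev (by positivity : 0 ≤ h * n * (B + 1) / 3)
  suffices hmain : (1 - h * B - 2 * (h * (3 + n * (B + 1)) / 6)) * G ≤
      (1 - h * B - h ^ 2 * n * B * (B - 1) / 2) * W +
      (h * n * (B + 1) / 2 * (1 - h * B - h ^ 2 * n * B * (B - 1) / 2 - 2 * h ^ 2 * B) -
        h ^ 2 * ((n : ℝ) - 1) * B * (B - 1) / 2) * A by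
    linarith
  rcases Nat.eq_or_lt_of_le hn with rfl | hn2
  · have hA0 := one_block_coeff_le hB hh.le (by simpa using hs)
    have hGW := hwin h hh
    simp only [Nat.cast_one, sub_self, zero_mul, mul_zero, add_zero, one_mul, mul_one,
      zero_div, sub_zero] at hs hGW hA0 ⊢ hθ0
    have hAA : 0 ≤ h * (B + 1) / 2 * (1 - h * B - h ^ 2 * B * (B - 1) / 2 - 2 * h ^ 2 * B) * A :=
      mul_nonneg (mul_nonneg (by positivity) (by linarith)) hA
    by_cases hZ : 1 - h * B - 2 * (h * (3 + (B + 1)) / 6) ≤ 0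
    · nlinarith [mul_nonneg hθ0 hW, mul_nonneg (neg_nonneg.2 hZ) hG]
    · have h1 := mul_le_mul_of_nonneg_left hGW (not_le.1 hZ).le
      have h2 : (1 - h * B - 2 * (h * (3 + (B + 1)) / 6)) * (1 + h) ≤
          1 - h * B - h ^ 2 * B * (B - 1) / 2 := by
        have : h * (h * B) * (B - 1) ≤ h * (2 / 3) * (B - 1) := by
          have : h * B ≤ 2 / 3 := by nlinarith
          have : 0 ≤ B - 1 := by linarith
          gcongr
        nlinarith [mul_nonneg hh.le hh.le]
      nlinarith [mul_le_mul_of_nonneg_right h2 hW]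
  · have hn2r : (2 : ℝ) ≤ n := by exact_mod_cast hn2
    have hprv := previous_window_coeff_le hn2r hB hh.le hs
    have hcur := current_window_coeff_le hn2r hB hh.le
    set ν := h * (3 + n * (B + 1)) / 6 with hν
    have hν0 : 0 < ν := by positivity
    have hB0 : 0 ≤ B := by linarith
    have hνB : 0 ≤ 1 - ν - h * B := by nlinarith [mul_nonneg hh.le (sub_nonneg.2 hB)]
    have hAA := mul_nonneg ((mul_nonneg hν0.le hνB).trans hprv) hA
    by_cases hZ : 1 - h * B - 2 * ν ≤ 0
    · nlinarith [mul_nonneg hθ0 hW, mul_nonneg (neg_nonneg.2 hZ) hG]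
    · have hpb : h ^ 2 * (((n : ℝ) - 1) * (B - 1)) ≤ ν ^ 2 := by
        have : (((n : ℝ) - 1) * (B - 1)) ≤ ((3 + n * (B + 1)) / 6) ^ 2 := by
          exact sub_one_mul_sub_one_le hnr hB
        calc _ ≤ h ^ 2 * ((3 + n * (B + 1)) / 6) ^ 2 := by gcongr
          _ = ν ^ 2 := by rw [hν]; ring
      have hG' : G ≤ (1 + ν) ^ 2 * W + (1 + ν) * ν * A := by
        calc G ≤ _ := hwin ν hν0
          _ = (1 + ν) * W + (1 + 1 / ν) * (h ^ 2 * (((n : ℝ) - 1) * (B - 1)) * (W + A)) := by ring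
          _ ≤ (1 + ν) * W + (1 + 1 / ν) * (ν ^ 2 * (W + A)) := by gcongr
          _ = _ := by field_simp; ring
      have h1 := mul_le_mul_of_nonneg_left hG' (not_le.1 hZ).le
      have h2 := mul_le_mul_of_nonneg_right hcur hW
      have h3 : (1 - h * B - 2 * ν) * ((1 + ν) * ν) ≤ ν * (1 - ν - h * B) := by
        have : 0 ≤ ν * (h * B * ν + 2 * ν ^ 2) := by positivity
        linarith
      have h4 := mul_le_mul_of_nonneg_right (h3.trans hprv) hA
      linarith

/-- Elimination of the window sums from three consecutive decrease estimates. -/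
lemma le_of_decrease_combination {γ a0 a1 a2 a3 P A A' A'' θ η q K C Γ Γ₀ : ℝ}
    (hγ : 0 ≤ γ) (hθ : 0 ≤ θ) (hq0 : 0 ≤ q) (hq : η ≤ q * θ) (hη : γ / 2 * η ≤ C)
    (hΓ₀ : 0 ≤ Γ₀) (hΓ : Γ₀ ≤ Γ) (hP : 0 ≤ P) (hA : 0 ≤ A) (hA' : 0 ≤ A') (hA'' : 0 ≤ A'')
    (hd1 : γ / 2 * (P + θ * A - η * A') ≤ a1 - a0) (hd2 : γ / 2 * (θ * A' - η * A'') ≤ a3 - a1)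
    (hd0 : a2 ≤ (1 - K) * a0 + Γ₀ * (γ / 2 * (P + θ * A))) :
    a2 ≤ (1 - K - Γ) * a0 + Γ * ((1 - q) * a1 + q * a3 + q * (C * A'')) := by
  have hE : γ / 2 * (P + θ * A) ≤ a1 - a0 + q * (a3 - a1 + C * A'') := by
    have h1 := mul_le_mul_of_nonneg_left hd2 hq0
    have h2 := mul_nonneg hq0 (mul_nonneg (sub_nonneg.2 hη) hA'')
    have h3 := mul_nonneg (by positivity : 0 ≤ γ / 2) (mul_nonneg (sub_nonneg.2 hq) hA')
    linarith
  have hΓE : Γ₀ * (γ / 2 * (P + θ * A)) ≤ Γ * (a1 - a0 + q * (a3 - a1 + C * A'')) :=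
    mul_le_mul hΓ hE (by positivity) (hΓ₀.trans hΓ)
  linarith

/-- The two-window recursion follows from the decrease estimates for three windows. -/
lemma recursion_of_decrease {n : ℕ} {B L μ γ a0 a1 a2 a3 G P W A A' A'' C1 C2 C3 C4 : ℝ}
    (hn : 1 ≤ n) (hB : 1 ≤ B) (hL : 0 < L) (hγ : 0 < γ) (hμ : 0 ≤ μ)
    (hs : L * γ * (n * B + B / 2 + 1) ≤ 1) (ha0 : 0 ≤ a0) (hPL : μ * a0 ≤ 1 / 2 * G)
    (hP : 0 ≤ P) (hA : 0 ≤ A) (hA' : 0 ≤ A') (hA'' : 0 ≤ A'')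
    (hd0 : γ / 2 * (G + (1 - L * γ * B - (L * γ) ^ 2 * n * B * (B - 1) / 2) * W -
      (L * γ) ^ 2 * ((n : ℝ) - 1) * B * (B - 1) / 2 * A) ≤ a0 - a2)
    (hd1 : γ / 2 * (P + (1 - L * γ * B - (L * γ) ^ 2 * n * B * (B - 1) / 2) * A -
      (L * γ) ^ 2 * ((n : ℝ) - 1) * B * (B - 1) / 2 * A') ≤ a1 - a0)
    (hd2 : γ / 2 * ((1 - L * γ * B - (L * γ) ^ 2 * n * B * (B - 1) / 2) * A' -
      (L * γ) ^ 2 * ((n : ℝ) - 1) * B * (B - 1) / 2 * A'') ≤ a3 - a1)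
    (hcomb : G ≤ L * γ * (B + 1) * G + L * γ * n * (B + 1) / 2 * P +
      (1 - L * γ * B - (L * γ) ^ 2 * n * B * (B - 1) / 2) * W +
      (L * γ * n * (B + 1) / 2 * (1 - L * γ * B - (L * γ) ^ 2 * n * B * (B - 1) / 2) -
        (L * γ) ^ 2 * ((n : ℝ) - 1) * B * (B - 1) / 2) * A)
    (hC1 : C1 = -μ * (γ ^ 4 * L ^ 2 * n * B + γ ^ 2 * (L * B + L) - 2 * γ))
    (hC2 : C2 = 1 / 2 * (n : ℝ) ^ 2 * B * γ ^ 4 * L ^ 3 + 1 / 2 * γ ^ 2 * L * (L + 1) * n)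
    (hC3 : C3 = L / 2 * γ ^ 2 * n * B)
    (hC4 : C4 = γ - γ ^ 2 * L * (B / 2 * (n + 1) + 1)) (hC4pos : 0 < C4) :
    a2 ≤ (1 - C1 - (C2 + C3) / C4) * a0 + (C2 + C3) / C4 *
      ((1 - C3 / C4) * a1 + C3 / C4 * a3 + L / 2 * n * B * (C3 / C4) * (γ ^ 2 * A'')) := by
  have hnr : (1 : ℝ) ≤ n := by exact_mod_cast hn
  have hB0 : 0 ≤ B := by linarith
  have hb : 0 ≤ B - 1 := by linarith
  have hp : 0 ≤ (n : ℝ) - 1 := by linarith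
  have hnB : 0 ≤ (n : ℝ) * B - B := by linarith [mul_nonneg hp hB0]
  have hθ := foreign_delay_coeff_le hnr hB (mul_pos hL hγ).le hs
  set θ := 1 - L * γ * B - (L * γ) ^ 2 * n * B * (B - 1) / 2
  set η := (L * γ) ^ 2 * ((n : ℝ) - 1) * B * (B - 1) / 2 with hη
  clear_value θ
  have hη0 : 0 ≤ η := by positivity
  have hθ0 : 0 ≤ θ := by
    have : 0 ≤ L * γ * ((n : ℝ) - 1) * (B - 1) := by positivity
    exact nonneg_of_mul_nonneg_right (this.trans hθ) (by linarith)
  have hC4γ : C4 ≤ γ := by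
    have : 0 ≤ γ ^ 2 * L * (B / 2 * (n + 1) + 1) := by positivity
    linarith
  have hC3pos : 0 ≤ C3 := by rw [hC3]; positivity
  have hq0 : 0 ≤ C3 / C4 := by positivity
  have hq : η ≤ C3 / C4 * θ := by
    have h1 : C4 * η ≤ C3 * θ := by
      calc C4 * η ≤ γ * η := by gcongr
        _ = L / 2 * γ ^ 2 * B * (L * γ * ((n : ℝ) - 1) * (B - 1)) := by rw [hη]; ring
        _ ≤ L / 2 * γ ^ 2 * B * (n * θ) := by gcongr
        _ = C3 * θ := by rw [hC3]; ring
    rw [div_mul_eq_mul_div, le_div_iff₀ hC4pos]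
    linarith
  have hη1 : γ / 2 * η ≤ C3 := by
    have h1 : L * γ * (B - 1) ≤ 1 := by
      have : 0 ≤ L * γ * (n * B - B + B / 2 + 2) := by
        positivity
      linarith
    have h2 : ((n : ℝ) - 1) * (L * γ * (B - 1)) ≤ n * 1 :=
      mul_le_mul (by linarith) h1 (by positivity) (by linarith)
    calc γ / 2 * η = L * γ ^ 2 * B / 4 * (((n : ℝ) - 1) * (L * γ * (B - 1))) := by rw [hη]; ring
      _ ≤ L * γ ^ 2 * B / 4 * (n * 1) := by gcongr
      _ ≤ C3 := by
        have : 0 ≤ L * γ ^ 2 * B * n := by positivity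
        rw [hC3]
        linarith
  have hΓ0 : 0 ≤ L * γ * n * (B + 1) / 2 := by positivity
  have hΓ : L * γ * n * (B + 1) / 2 ≤ (C2 + C3) / C4 := by
    rw [le_div_iff₀ hC4pos]
    calc L * γ * n * (B + 1) / 2 * C4 ≤ L * γ * n * (B + 1) / 2 * γ := by gcongr
      _ ≤ C2 + C3 := by
        have : 0 ≤ 1 / 2 * (n : ℝ) ^ 2 * B * γ ^ 4 * L ^ 3 + 1 / 2 * γ ^ 2 * L * L * n := by
          positivity
        rw [hC2, hC3]
        linarith
  have hC1a : C1 * a0 ≤ γ * (1 - L * γ * (B + 1) / 2) * G := by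
    have h1 : 0 ≤ γ * (2 - L * γ * (B + 1)) := by
      have : 0 ≤ L * γ * (n * B - B + B / 2) := by
        positivity
      exact mul_nonneg hγ.le (by linarith)
    have h2 := mul_le_mul_of_nonneg_left hPL h1
    have h3 : 0 ≤ μ * (γ ^ 4 * L ^ 2 * n * B) * a0 := by positivity
    rw [hC1]
    linarith
  have hfin := mul_le_mul_of_nonneg_left hcomb (half_pos hγ).le
  have hq3 : L / 2 * n * B * (C3 / C4) * (γ ^ 2 * A'') = C3 / C4 * (C3 * A'') := by
    rw [hC3]; ring
  rw [hq3]
  clear_value η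
  exact le_of_decrease_combination hγ.le hθ0 hq0 hq hη1 hΓ0 hΓ hP hA hA' hA'' hd1 hd2
    (by linarith)

theorem alpha_recursion_two
    (m n B : ℕ) (hn : 0 < n) (hB : 1 ≤ B)
    (f : EuclideanSpace ℝ (Fin m) → ℝ) (μ L γ fstar : ℝ)
    (hμ : 0 < μ) (hL : 0 < L) (hγ : 0 < γ)
    (hdiff : Differentiable ℝ f)
    (hmin : ∀ z, fstar ≤ f z) (hattain : ∃ z, f z = fstar)
    (hPL : ∀ z, μ * (f z - fstar) ≤ (1 / 2) * ‖gradient f z‖ ^ 2)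
    (hLip : ∀ y z, ‖gradient f z - gradient f y‖ ≤ L * ‖z - y‖)
    (hstatfin : {z : EuclideanSpace ℝ (Fin m) | gradient f z = 0}.Finite)
    (hstatne : {z : EuclideanSpace ℝ (Fin m) | gradient f z = 0}.Nonempty)
    (blk : Fin m → Fin n) (T : Fin n → Set ℕ) (τ : Fin n → Fin n → ℕ → ℕ)
    (X : Fin n → ℕ → EuclideanSpace ℝ (Fin m))
    (x s : ℕ → EuclideanSpace ℝ (Fin m))
    (hτle : ∀ i j t, τ i j t ≤ t)
    (hread : ∀ i j, j ≠ i → ∀ t c, blk c = j → X i t c = X j (τ i j t) c)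
    (hupd : ∀ i t c, blk c = i →
      X i (t + 1) c = if t ∈ T i then X i t c - γ * gradient f (X i t) c else X i t c)
    (hx : ∀ t c, x t c = X (blk c) t c)
    (hs : ∀ t c, s t c = if t ∈ T (blk c) then -(gradient f (X (blk c) t) c) else 0)
    (hasync1 : ∀ i t, ∃ t' ∈ Finset.Ico t (t + B), t' ∈ T i)
    (hasync2 : ∀ i j t, t ∈ T i → j ≠ i → t < τ i j t + B)
    (alpha beta : ℕ → ℝ)
    (halpha : ∀ t, alpha t = f (x t) - fstar)
    (hbeta : ∀ t, beta t = γ ^ 2 * ∑ τ' ∈ Finset.Ico (t - B) t, ‖s τ'‖ ^ 2)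
    (hγmin : γ < min ((2 / L) * (1 / (L * (n : ℝ) ^ 2 * (B : ℝ) + (B : ℝ) + 1))) (1 / (L * ((B : ℝ) / 2) * ((n : ℝ) + 1) + L + (L / 2) * (n : ℝ) * (B : ℝ))))
    (C1 C2 C3 C4 : ℝ)
    (hC1 : C1 = -μ * (γ ^ 4 * L ^ 2 * (n : ℝ) * (B : ℝ) + γ ^ 2 * (L * (B : ℝ) + L) - 2 * γ))
    (hC2 : C2 = (1 / 2) * (n : ℝ) ^ 2 * (B : ℝ) * γ ^ 4 * L ^ 3 + (1 / 2) * γ ^ 2 * L * (L + 1) * (n : ℝ))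
    (hC3 : C3 = (L / 2) * γ ^ 2 * (n : ℝ) * (B : ℝ))
    (hC4 : C4 = γ - γ ^ 2 * L * (((B : ℝ) / 2) * ((n : ℝ) + 1) + 1)) (hC4pos : 0 < C4) :
    ∀ t : ℕ, 3 * B ≤ t →
      alpha (t + B) ≤ (1 - C1 - (C2 + C3) / C4) * alpha t +
        ((C2 + C3) / C4) * ((1 - C3 / C4) * alpha (t - B) + (C3 / C4) * alpha (t - 2 * B) +
          (L / 2) * (n : ℝ) * (B : ℝ) * (C3 / C4) * beta (t - 2 * B)) := by
  have h : IsAsyncDescent (gradient f) γ B blk T τ X x s :=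
    ⟨hτle, hread, hupd, hx, hs, hasync1, hasync2⟩
  have hBr : (1 : ℝ) ≤ B := by exact_mod_cast hB
  have hstep : L * γ * (n * B + B / 2 + 1) ≤ 1 := by
    have h1 := (lt_min_iff.1 hγmin).2
    rw [lt_div_iff₀ (by positivity)] at h1
    linarith
  intro t ht
  have e1 : t - B + B = t := by omega
  have e2 : t - 2 * B + B = t - B := by omega
  have e3 : t - B - B = t - 2 * B := by omega
  have d0 := h.window_decrease hdiff hL.le hγ.le hLip (t := t) (by omega)
  have d1 := h.window_decrease hdiff hL.le hγ.le hLip (t := t - B) (by omega)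
  have d2 := h.window_decrease hdiff hL.le hγ.le hLip (t := t - 2 * B) (by omega)
  rw [e1, e3] at d1
  rw [e2] at d2
  have hnonneg : ∀ I : Finset ℕ, 0 ≤ ∑ σ ∈ I, ‖s σ‖ ^ 2 := fun _ =>
    Finset.sum_nonneg fun _ _ => sq_nonneg _
  have hcomb := gradient_sq_le_combination hn hBr (mul_pos hL hγ) hstep
    (sq_nonneg ‖gradient f (x t)‖)
    (hnonneg _) (hnonneg _) (fun _ hε => h.norm_sq_le_window hLip (by omega) hε)
    (h.norm_gradient_sq_le_previous hLip (by omega))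
  rw [hbeta]
  simp only [halpha]
  refine recursion_of_decrease hn hBr hL hγ hμ.le hstep (sub_nonneg.2 (hmin _)) (hPL (x t))
    (sq_nonneg _) (hnonneg _) (hnonneg _) (hnonneg _) (d0.trans_eq (by ring))
    (d1.trans_eq (by ring)) ?_ hcomb hC1 hC2 hC3 hC4 hC4pos
  have : 0 ≤ γ / 2 * ‖gradient f (x (t - 2 * B))‖ ^ 2 := by positivity
  linarith
end
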